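/- arXiv:1902.09168 — 13 statements merged into one kernel-verified Lean document; each statement's English description precedes it below -/
import Mathlib

section
/- For a permutation w of [n] = {1,…,n}, the following are equivalent: (a) w is vexillary; (b) the essential set Ess(D(w)) of the Rothe diagram of w is a chain under the southwest-to-northeast order ⊑; (c) the row sets D_i(w) = {j : (i,j) ∈ D(w)}, for i ∈ [n], are totally ordered under inclusion. -/
open Classical

namespace UGS

/-- `w ∈ S_n`: a permutation of `ℕ` fixing everything outside `[1, n]`. -/
def IsPermOn (n : ℕ) (w : Equiv.Perm ℕ) : Prop :=
  ∀ i : ℕ, i ∉ Finset.Icc 1 n → w i = i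

/-- The Rothe diagram `D(w) = {(i,j) ∈ [n]×[n] : j < w(i), i < w⁻¹(j)}`. -/
def Rothe (n : ℕ) (w : Equiv.Perm ℕ) : Set (ℕ × ℕ) :=
  {p | p.1 ∈ Finset.Icc 1 n ∧ p.2 ∈ Finset.Icc 1 n ∧ p.2 < w p.1 ∧ p.1 < w.symm p.2}

/-- The essential set `Ess(D) = {(i,j) ∈ D : (i,j+1) ∉ D, (i+1,j) ∉ D}`. -/
def Ess (D : Set (ℕ × ℕ)) : Set (ℕ × ℕ) :=
  {p | p ∈ D ∧ (p.1, p.2 + 1) ∉ D ∧ (p.1 + 1, p.2) ∉ D}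

/-- Southwest-to-northeast order: `(i,j) ⊑ (i',j')` iff `i ≥ i'` and `j ≤ j'`. -/
def Swne (p q : ℕ × ℕ) : Prop := q.1 ≤ p.1 ∧ p.2 ≤ q.2

/-- Strict version of the southwest-to-northeast order. -/
def SwneLt (p q : ℕ × ℕ) : Prop := Swne p q ∧ p ≠ q

/-- A set of cells is a chain under the southwest-to-northeast order. -/
def IsSwneChain (S : Set (ℕ × ℕ)) : Prop :=
  ∀ p ∈ S, ∀ q ∈ S, Swne p q ∨ Swne q p

/-- `w` is vexillary: it avoids the pattern 2143 on `[n]`. -/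
def Vexillary (n : ℕ) (w : Equiv.Perm ℕ) : Prop :=
  ¬ ∃ i j k l : ℕ, 1 ≤ i ∧ i < j ∧ j < k ∧ k < l ∧ l ≤ n ∧
      w j < w i ∧ w i < w l ∧ w l < w k

/-- `rank w_{[i][j]} = #{a ∈ [i] : w(a) ∈ [j]}`. -/
def rankUL (w : Equiv.Perm ℕ) (i j : ℕ) : ℕ :=
  ((Finset.Icc 1 i).filter fun a => w a ∈ Finset.Icc 1 j).card

/-- The code `c_i(w) = #{j > i : w(j) < w(i)}`. -/
def code (n : ℕ) (w : Equiv.Perm ℕ) (i : ℕ) : ℕ :=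
  ((Finset.Ioc i n).filter fun j => w j < w i).card

/-- The shape `sh(w)_k = #{i ∈ [n] : c_i(w) ≥ k}`. -/
def shape (n : ℕ) (w : Equiv.Perm ℕ) (k : ℕ) : ℕ :=
  ((Finset.Icc 1 n).filter fun i => k ≤ code n w i).card

theorem permOn_mem (n : ℕ) (w : Equiv.Perm ℕ) (hw : IsPermOn n w) (i : ℕ) :
    (1 ≤ w i ∧ w i ≤ n) ↔ (1 ≤ i ∧ i ≤ n) := by
  have h1 := hw i
  have h2 := hw (w i)
  simp only [Finset.mem_Icc] at h1 h2
  constructor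
  · intro h
    by_contra h'
    rw [h1 h'] at h
    exact h' h
  · intro h
    by_contra h'
    have := w.injective (h2 h')
    rw [this] at h'
    exact h' h

theorem permOn_symm_mem (n : ℕ) (w : Equiv.Perm ℕ) (hw : IsPermOn n w) (i : ℕ) :
    (1 ≤ w.symm i ∧ w.symm i ≤ n) ↔ (1 ≤ i ∧ i ≤ n) := by
  have := permOn_mem n w hw (w.symm i)
  rw [Equiv.apply_symm_apply] at this
  exact this.symm

theorem mem_Rothe_iff (n : ℕ) (w : Equiv.Perm ℕ) (hw : IsPermOn n w) (a b : ℕ) :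
    (a, b) ∈ Rothe n w ↔ 1 ≤ a ∧ 1 ≤ b ∧ w.symm b ≤ n ∧ w a ≤ n ∧ b < w a ∧ a < w.symm b := by
  have h1 := permOn_mem n w hw a
  have h2 := permOn_symm_mem n w hw b
  simp only [Rothe, Set.mem_setOf_eq, Finset.mem_Icc]
  omega

theorem exists_ess (n : ℕ) (w : Equiv.Perm ℕ) (hw : IsPermOn n w) (i j : ℕ)
    (hi : 1 ≤ i) (hij : i < j) (hj : j ≤ n) (h : w j < w i) :
    ∃ a b, (a, b) ∈ Ess (Rothe n w) ∧ i ≤ a ∧ a < j ∧ w j ≤ b ∧ b < w i := by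
  let S : Finset (ℕ × ℕ) :=
    (Finset.Ico i j ×ˢ Finset.Ico (w j) (w i)).filter fun p => p ∈ Rothe n w
  have hmem : ∀ a b, (a, b) ∈ S ↔
      ((i ≤ a ∧ a < j) ∧ (w j ≤ b ∧ b < w i)) ∧ (a, b) ∈ Rothe n w := by
    intro a b; simp [S]
  have hS : S.Nonempty := by
    refine ⟨(i, w j), (hmem _ _).2 ⟨⟨⟨le_rfl, hij⟩, le_rfl, h⟩, ?_⟩⟩
    rw [mem_Rothe_iff n w hw]
    have h1 := permOn_mem n w hw i
    have h2 := permOn_mem n w hw j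
    simp only [Equiv.symm_apply_apply]
    omega
  obtain ⟨⟨a, b⟩, hab, hmax⟩ := S.exists_max_image (fun p => p.1 + p.2) hS
  obtain ⟨⟨⟨h1, h2⟩, h3, h4⟩, hD⟩ := (hmem _ _).1 hab
  refine ⟨a, b, ⟨hD, ?_, ?_⟩, h1, h2, h3, h4⟩
  · intro hE
    by_cases hb : b + 1 = w i
    · have hE' := (mem_Rothe_iff n w hw _ _).1 hE
      simp only [hb, Equiv.symm_apply_apply] at hE'
      omega
    · have := hmax (a, b + 1) ((hmem _ _).2 ⟨⟨⟨h1, h2⟩, by omega, by omega⟩, hE⟩)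
      simp only at this
      omega
  · intro hE
    by_cases hb : a + 1 = j
    · have hE' := (mem_Rothe_iff n w hw _ _).1 hE
      simp only [hb] at hE'
      omega
    · have := hmax (a + 1, b) ((hmem _ _).2 ⟨⟨⟨by omega, by omega⟩, h3, h4⟩, hE⟩)
      simp only at this
      omega

theorem no_nw (n : ℕ) (w : Equiv.Perm ℕ) (hw : IsPermOn n w) (hv : Vexillary n w)
    (i j i' j' : ℕ) (hp : (i, j) ∈ Ess (Rothe n w)) (hq : (i', j') ∈ Ess (Rothe n w))
    (hi : i < i') (hj : j < j') : False := by
  obtain ⟨hp, hpE, hpS⟩ := hp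
  obtain ⟨hq, -, -⟩ := hq
  simp only [mem_Rothe_iff n w hw] at hp hpE hpS hq
  have e1 : w (w.symm (j + 1)) = j + 1 := w.apply_symm_apply _
  have e2 : w (w.symm j') = j' := w.apply_symm_apply _
  have e3 : w (w.symm j) = j := w.apply_symm_apply _
  have e4 : j + 1 = w i → w.symm (j + 1) = i := fun h => by rw [h, w.symm_apply_apply]
  have e5 : i + 1 = w.symm j → w (i + 1) = j := fun h => by rw [h, w.apply_symm_apply]
  have m1 := permOn_mem n w hw (i + 1)
  have m2 := permOn_symm_mem n w hw (j + 1)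
  have hA : w.symm (j + 1) ≤ i := by
    by_contra hc
    omega
  have hB : w (i + 1) ≤ j := by
    by_contra hc
    omega
  have n1 : i + 1 ≠ i' := by rintro rfl; omega
  have n2 : j + 1 ≠ j' := by rintro rfl; omega
  exact hv ⟨w.symm (j + 1), i + 1, i', w.symm j', by omega, by omega, by omega, by omega,
    by omega, by omega, by omega, by omega⟩

theorem rows_aux (n : ℕ) (w : Equiv.Perm ℕ) (hw : IsPermOn n w) (hv : Vexillary n w)
    (i i' j j' : ℕ) (hi : i < i') (h1 : (i, j) ∈ Rothe n w) (h2 : (i', j) ∉ Rothe n w)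
    (h3 : (i', j') ∈ Rothe n w) (h4 : (i, j') ∉ Rothe n w) : False := by
  simp only [mem_Rothe_iff n w hw] at h1 h2 h3 h4
  have e2 : w (w.symm j') = j' := w.apply_symm_apply _
  have e3 : w (w.symm j) = j := w.apply_symm_apply _
  have e4 : j' = w i → w.symm j' = i := fun h => by rw [h, w.symm_apply_apply]
  have e5 : i' = w.symm j → w i' = j := fun h => by rw [h, w.apply_symm_apply]
  exact hv ⟨i, w.symm j, i', w.symm j', by omega, by omega, by omega, by omega,
    by omega, by omega, by omega, by omega⟩

theorem vexillary_tfae (n : ℕ) (w : Equiv.Perm ℕ) (hw : IsPermOn n w) :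
    (Vexillary n w ↔ IsSwneChain (Ess (Rothe n w))) ∧
    (Vexillary n w ↔
      ∀ i ∈ Finset.Icc 1 n, ∀ i' ∈ Finset.Icc 1 n,
        {j : ℕ | (i, j) ∈ Rothe n w} ⊆ {j : ℕ | (i', j) ∈ Rothe n w} ∨
        {j : ℕ | (i', j) ∈ Rothe n w} ⊆ {j : ℕ | (i, j) ∈ Rothe n w}) := by
  refine ⟨⟨?_, ?_⟩, ?_, ?_⟩
  · rintro hv ⟨i, j⟩ hp ⟨i', j'⟩ hq
    have a1 := no_nw n w hw hv i j i' j' hp hq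
    have a2 := no_nw n w hw hv i' j' i j hq hp
    simp only [Swne]
    by_contra hc
    by_cases c1 : i < i'
    · exact a1 c1 (by omega)
    · exact a2 (by omega) (by omega)
  · rintro hc ⟨i, j, k, l, h1, h2, h3, h4, h5, h6, h7, h8⟩
    obtain ⟨a, b, hE, _, _, _, _⟩ := exists_ess n w hw i j h1 h2 (by omega) h6
    obtain ⟨a', b', hE', _, _, _, _⟩ := exists_ess n w hw k l (by omega) h4 h5 h8
    have := hc _ hE _ hE'
    simp only [Swne] at this
    omega
  · intro hv i _ i' _
    by_contra hc
    simp only [not_or, Set.not_subset, Set.mem_setOf_eq] at hc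
    obtain ⟨⟨j, h1, h2⟩, j', h3, h4⟩ := hc
    rcases lt_trichotomy i i' with h | h | h
    · exact rows_aux n w hw hv i i' j j' h h1 h2 h3 h4
    · subst h; exact h2 h1
    · exact rows_aux n w hw hv i' i j' j h h3 h4 h1 h2
  · rintro hc ⟨i, j, k, l, h1, h2, h3, h4, h5, h6, h7, h8⟩
    have mi := permOn_mem n w hw i
    have mj := permOn_mem n w hw j
    have mk := permOn_mem n w hw k
    have ml := permOn_mem n w hw l
    rcases hc i (Finset.mem_Icc.2 (by omega)) k (Finset.mem_Icc.2 (by omega)) with h | h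
    · have := @h (w j) (by
        simp only [Set.mem_setOf_eq, mem_Rothe_iff n w hw, Equiv.symm_apply_apply]; omega)
      simp only [Set.mem_setOf_eq, mem_Rothe_iff n w hw, Equiv.symm_apply_apply] at this
      omega
    · have := @h (w l) (by
        simp only [Set.mem_setOf_eq, mem_Rothe_iff n w hw, Equiv.symm_apply_apply]; omega)
      simp only [Set.mem_setOf_eq, mem_Rothe_iff n w hw, Equiv.symm_apply_apply] at this
      omega
end UGS
end

section
/- Let w ∈ S_n be vexillary, write Ess(D(w)) = {(i_1,j_1) ⊏ ⋯ ⊏ (i_s,j_s)} (a chain under the southwest-to-northeast order), and set k_p = j_p − rank w_{[i_p][j_p]} for p ∈ [s]. Then {k_1,…,k_s} equals the set {c_1(w),…,c_n(w)} \ {0} of nonzero values of the code of w. -/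
open Classical

namespace UGS

theorem perm_range {n : ℕ} {w : Equiv.Perm ℕ} (hw : IsPermOn n w) (p : ℕ) :
    (1 ≤ w p ∧ w p ≤ n) ↔ (1 ≤ p ∧ p ≤ n) := by
  constructor
  · intro h
    by_contra hc
    have := hw p (by simpa using hc)
    rw [this] at h
    exact hc h
  · intro h
    by_contra hc
    have := hw (w p) (by simpa using hc)
    have h2 := w.injective this
    rw [h2] at hc
    exact hc h

theorem sub_rank {n : ℕ} {w : Equiv.Perm ℕ} (hw : IsPermOn n w) (i j : ℕ) (hi : i ≤ n)
    (hj : j ≤ n) :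
    j - rankUL w i j = ((Finset.Ioc i n).filter fun p => w p ≤ j).card := by
  have h1 : ((Finset.Icc 1 n).filter fun p => w p ≤ j).card = j := by
    have : ((Finset.Icc 1 n).filter fun p => w p ≤ j) =
        (Finset.Icc 1 j).map w.symm.toEmbedding := by
      ext p
      have := perm_range hw p
      simp only [Finset.mem_filter, Finset.mem_Icc, Finset.mem_map_equiv, Equiv.symm_symm]
      omega
    rw [this, Finset.card_map]; simp
  have h2 : ((Finset.Icc 1 n).filter fun p => w p ≤ j) =
      ((Finset.Icc 1 i).filter fun a => w a ∈ Finset.Icc 1 j) ∪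
      ((Finset.Ioc i n).filter fun p => w p ≤ j) := by
    ext p
    have := perm_range hw p
    simp only [Finset.mem_filter, Finset.mem_Icc, Finset.mem_union, Finset.mem_Ioc]
    omega
  have h3 : Disjoint ((Finset.Icc 1 i).filter fun a => w a ∈ Finset.Icc 1 j)
      ((Finset.Ioc i n).filter fun p => w p ≤ j) := by
    rw [Finset.disjoint_left]
    intro p
    simp only [Finset.mem_filter, Finset.mem_Icc, Finset.mem_Ioc]
    omega
  rw [h2, Finset.card_union_of_disjoint h3] at h1
  unfold rankUL
  omega

theorem ess_code {n : ℕ} {w : Equiv.Perm ℕ} (hw : IsPermOn n w) (hvex : Vexillary n w)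
    (i j : ℕ) (h : (i, j) ∈ Ess (Rothe n w)) :
    (∃ r, 1 ≤ r ∧ r ≤ n ∧ code n w r = j - rankUL w i j) ∧ j - rankUL w i j ≠ 0 := by
  obtain ⟨⟨hi, hj, h1, h2⟩, h3, h4⟩ := h
  simp only [Rothe, Set.mem_setOf_eq, Finset.mem_Icc] at hi hj h1 h2 h3 h4
  rw [sub_rank hw i j hi.2 hj.2]
  have hwi := perm_range hw i
  have hjp := perm_range hw (w.symm j)
  have hj1 := perm_range hw (w.symm (j+1))
  have e1 := w.apply_symm_apply j
  have e2 := w.apply_symm_apply (j+1)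
  generalize w.symm j = q at *
  generalize w.symm (j+1) = r at *
  rw [e1] at hjp
  rw [e2] at hj1
  have hri : r ≤ i := by
    by_contra hc
    apply h3
    refine ⟨hi, by omega, ?_, by omega⟩
    by_contra hh
    have : w i = w r := by omega
    have := w.injective this
    omega
  constructor
  · by_cases hA : ∃ a, r < a ∧ a ≤ i ∧ w a ≤ j
    · by_cases hB : ∃ l, i < l ∧ l ≤ n ∧ j + 1 < w l ∧ w l < w i
      · exfalso
        obtain ⟨a, ha1, ha2, ha3⟩ := hA
        obtain ⟨l, hl1, hl2, hl3, hl4⟩ := hB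
        have hai : a ≠ i := by rintro rfl; omega
        exact hvex ⟨r, a, i, l, by omega, ha1, by omega, hl1, hl2, by omega, by omega, hl4⟩
      · refine ⟨i, hi.1, hi.2, ?_⟩
        unfold code
        congr 1
        ext p
        simp only [Finset.mem_filter, Finset.mem_Ioc]
        constructor
        · rintro ⟨hp, hp2⟩
          refine ⟨hp, ?_⟩
          by_contra hc
          have : w p ≠ j + 1 := by
            intro hh
            have := w.injective (hh.trans e2.symm)
            omega
          exact hB ⟨p, hp.1, hp.2, by omega, hp2⟩
        · rintro ⟨hp, hp2⟩
          exact ⟨hp, by omega⟩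
    · refine ⟨r, by omega, by omega, ?_⟩
      unfold code
      congr 1
      ext p
      simp only [Finset.mem_filter, Finset.mem_Ioc]
      rw [e2]
      constructor
      · rintro ⟨hp, hp2⟩
        refine ⟨⟨?_, hp.2⟩, by omega⟩
        by_contra hc
        exact hA ⟨p, hp.1, by omega, by omega⟩
      · rintro ⟨hp, hp2⟩
        exact ⟨by omega, by omega⟩
  · apply Finset.card_ne_zero_of_mem (a := q)
    simp only [Finset.mem_filter, Finset.mem_Ioc]
    omega

theorem code_ess {n : ℕ} {w : Equiv.Perm ℕ} (hw : IsPermOn n w)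
    (i : ℕ) (hi : 1 ≤ i ∧ i ≤ n) (h : code n w i ≠ 0) :
    ∃ x ∈ Ess (Rothe n w), x.2 - rankUL w x.1 x.2 = code n w i := by
  have hne : ((Finset.Ioc i n).filter fun j => w j < w i).Nonempty := by
    rw [← Finset.card_ne_zero]; exact h
  obtain ⟨q, hq, hmax⟩ := Finset.exists_max_image _ (fun p => w p) hne
  simp only [Finset.mem_filter, Finset.mem_Ioc] at hq hmax
  have hex : ∃ r, i < r ∧ w r ≤ w q := ⟨q, hq.1.1, le_rfl⟩
  obtain ⟨hf1, hf2⟩ := Nat.find_spec hex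
  have hf3 : Nat.find hex ≤ q := Nat.find_min' hex ⟨hq.1.1, le_rfl⟩
  have hf4 : ∀ t, i < t → t < Nat.find hex → w q < w t := by
    intro t h1 h2
    have := Nat.find_min hex h2
    by_contra hc
    exact this ⟨h1, by omega⟩
  generalize Nat.find hex = f at *
  obtain ⟨g, rfl⟩ : ∃ g, f = g + 1 := ⟨f - 1, by omega⟩
  have hwq := perm_range hw q
  have hwi := perm_range hw i
  have hwg : w q < w g := by
    rcases Nat.lt_or_ge i g with hh | hh
    · exact hf4 g hh (by omega)
    · have : g = i := by omega
      subst this; exact hq.2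
  refine ⟨(g, w q), ⟨?_, ?_, ?_⟩, ?_⟩
  · simp only [Rothe, Set.mem_setOf_eq, Finset.mem_Icc, Equiv.symm_apply_apply]
    refine ⟨by omega, by omega, hwg, by omega⟩
  · simp only [Rothe, Set.mem_setOf_eq, Finset.mem_Icc]
    rintro ⟨-, hb, hb2, hb3⟩
    have e2 := w.apply_symm_apply (w q + 1)
    have hr := perm_range hw (w.symm (w q + 1))
    generalize w.symm (w q + 1) = r at *
    rw [e2] at hr
    have hne2 : w r ≠ w i := by
      intro hh
      have := w.injective hh
      omega
    have := hmax r ⟨by omega, by omega⟩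
    omega
  · simp only [Rothe, Set.mem_setOf_eq, Finset.mem_Icc]
    rintro ⟨-, -, hb, -⟩
    omega
  · simp only
    rw [sub_rank hw g (w q) (by omega) (by omega)]
    unfold code
    congr 1
    ext p
    simp only [Finset.mem_filter, Finset.mem_Ioc]
    constructor
    · rintro ⟨hp, hp2⟩
      exact ⟨by omega, by omega⟩
    · rintro ⟨hp, hp2⟩
      have := hmax p ⟨hp, hp2⟩
      refine ⟨⟨?_, hp.2⟩, this⟩
      by_contra hc
      have := hf4 p hp.1 (by omega)
      omega

theorem code_values_eq_essential_ks (n : ℕ) (w : Equiv.Perm ℕ)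
    (hw : IsPermOn n w) (hvex : Vexillary n w)
    (s : ℕ) (e : ℕ → ℕ × ℕ)
    (hchain : ∀ p q, 1 ≤ p → p < q → q ≤ s → SwneLt (e p) (e q))
    (hrange : Ess (Rothe n w) = {x | ∃ p, 1 ≤ p ∧ p ≤ s ∧ e p = x})
    (k : ℕ → ℕ)
    (hk : ∀ p, 1 ≤ p → p ≤ s → k p = (e p).2 - rankUL w (e p).1 (e p).2) :
    {m : ℕ | ∃ p, 1 ≤ p ∧ p ≤ s ∧ k p = m}
      = {m : ℕ | ∃ i, 1 ≤ i ∧ i ≤ n ∧ code n w i = m} \ {0} := by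
  ext m
  simp only [Set.mem_setOf_eq, Set.mem_diff, Set.mem_singleton_iff]
  constructor
  · rintro ⟨p, h1, h2, rfl⟩
    have hm : e p ∈ Ess (Rothe n w) := by
      rw [hrange]; exact ⟨p, h1, h2, rfl⟩
    rw [hk p h1 h2]
    exact ess_code hw hvex (e p).1 (e p).2 hm
  · rintro ⟨⟨i, h1, h2, rfl⟩, h0⟩
    obtain ⟨x, hx, hx2⟩ := code_ess hw i ⟨h1, h2⟩ h0
    rw [hrange] at hx
    obtain ⟨p, hp1, hp2, rfl⟩ := hx
    exact ⟨p, hp1, hp2, by rw [hk p hp1 hp2, hx2]⟩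
end UGS
end

section
/- Let w ∈ S_n be vexillary, write Ess(D(w)) = {(i_1,j_1) ⊏ ⋯ ⊏ (i_s,j_s)}, set k_p = j_p − rank w_{[i_p][j_p]} for p ∈ [s] and k_0 = 0. If k is an integer with k_{p−1} < k ≤ k_p for some p ∈ [s], then sh(w)_k = sh(w)_{k_p} = i_p − rank w_{[i_p][j_p]}. -/
open Classical

namespace UGS

theorem aux_pos (n : ℕ) (w : Equiv.Perm ℕ) (hw : IsPermOn n w) (a : ℕ) (ha : 1 ≤ a) : 1 ≤ w a := by
  have h0 : w 0 = 0 := hw 0 (by simp)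
  by_contra h
  have h1 : w a = w 0 := by omega
  have := w.injective h1
  omega

theorem aux_le (n : ℕ) (w : Equiv.Perm ℕ) (hw : IsPermOn n w) (a : ℕ) (ha : a ≤ n) : w a ≤ n := by
  by_contra h
  have h1 : w (w a) = w a := hw _ (by simp; omega)
  have := w.injective h1
  omega

theorem aux_symm (n : ℕ) (w : Equiv.Perm ℕ) (hw : IsPermOn n w) : IsPermOn n w.symm := by
  intro i hi
  rw [Equiv.symm_apply_eq]
  exact (hw i hi).symm

theorem aux_K (n : ℕ) (w : Equiv.Perm ℕ) (hw : IsPermOn n w) (i j : ℕ) (hi : i ≤ n) (hj : j ≤ n) :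
    ((Finset.Ioc i n).filter fun a => w a ≤ j).card = j - rankUL w i j := by
  have h1 : ((Finset.Ioc i n).filter fun a => w a ≤ j) ∪
      ((Finset.Icc 1 i).filter fun a => w a ∈ Finset.Icc 1 j) =
      (Finset.Icc 1 j).image w.symm := by
    ext a
    simp only [Finset.mem_union, Finset.mem_filter, Finset.mem_Ioc, Finset.mem_Icc, Finset.mem_image]
    constructor
    · rintro (⟨⟨h1, h2⟩, h3⟩ | ⟨⟨h1, h2⟩, h3⟩)
      · exact ⟨w a, ⟨aux_pos n w hw a (by omega), h3⟩, by simp⟩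
      · exact ⟨w a, h3, by simp⟩
    · rintro ⟨b, ⟨h1, h2⟩, rfl⟩
      have h3 := aux_pos n w.symm (aux_symm n w hw) b h1
      have h4 := aux_le n w.symm (aux_symm n w hw) b (by omega)
      simp only [Equiv.apply_symm_apply]
      omega
  have h2 : Disjoint ((Finset.Ioc i n).filter fun a => w a ≤ j)
      ((Finset.Icc 1 i).filter fun a => w a ∈ Finset.Icc 1 j) := by
    rw [Finset.disjoint_left]
    intro a
    simp only [Finset.mem_filter, Finset.mem_Ioc, Finset.mem_Icc]
    omega
  have h3 := Finset.card_union_of_disjoint h2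
  rw [h1, Finset.card_image_of_injective _ w.symm.injective, Nat.card_Icc] at h3
  unfold rankUL
  omega

theorem aux_R (n : ℕ) (w : Equiv.Perm ℕ) (hw : IsPermOn n w) (i j : ℕ) :
    ((Finset.Icc 1 i).filter fun a => j < w a).card = i - rankUL w i j := by
  have h := Finset.card_filter_add_card_filter_not (s := Finset.Icc 1 i)
    (fun a => w a ∈ Finset.Icc 1 j)
  have h1 : (Finset.Icc 1 i).filter (fun a => ¬ w a ∈ Finset.Icc 1 j) =
      (Finset.Icc 1 i).filter fun a => j < w a := by
    apply Finset.filter_congr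
    intro a ha
    simp only [Finset.mem_Icc] at ha ⊢
    have := aux_pos n w hw a ha.1
    omega
  rw [h1, Nat.card_Icc] at h
  unfold rankUL
  omega

theorem aux_ess (n : ℕ) (w : Equiv.Perm ℕ) (hw : IsPermOn n w) (i : ℕ) (hi : 1 ≤ i) (hin : i ≤ n)
    (hc : 1 ≤ code n w i) :
    ∃ x ∈ Ess (Rothe n w), i ≤ x.1 ∧ x.2 < w i ∧
      code n w i ≤ ((Finset.Ioc x.1 n).filter fun a => w a ≤ x.2).card := by
  have hne : ((Finset.Ioc i n).filter fun j => w j < w i).Nonempty := Finset.card_pos.mp hc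
  obtain ⟨b, hb, hmax⟩ := Finset.exists_max_image _ (fun a => w a) hne
  simp only [Finset.mem_filter, Finset.mem_Ioc] at hb hmax
  have hex : ∃ r, i < r ∧ w r ≤ w b := ⟨b, hb.1.1, le_rfl⟩
  obtain ⟨hr1, hr2⟩ := Nat.find_spec hex
  have hmin := fun m => Nat.find_min (H := hex) (m := m)
  have hrb := Nat.find_min' hex ⟨hb.1.1, le_rfl⟩
  generalize Nat.find hex = r at *
  obtain ⟨t, rfl⟩ : ∃ t, r = t + 1 := ⟨r - 1, by omega⟩
  have hwt : w b < w t := by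
    rcases Nat.lt_or_ge i t with h | h
    · have := hmin t (by omega)
      omega
    · have : t = i := by omega
      rw [this]; exact hb.2
  have hb1 := aux_pos n w hw b (by omega)
  have hbn := aux_le n w hw b hb.1.2
  refine ⟨(t, w b), ⟨?_, ?_, ?_⟩, by simp only; omega, hb.2, ?_⟩
  · simp only [Rothe, Set.mem_setOf_eq, Finset.mem_Icc, Equiv.symm_apply_apply]
    omega
  · simp only [Rothe, Set.mem_setOf_eq, Finset.mem_Icc]
    rintro ⟨h1, h2, h3, h4⟩
    have h5 := aux_le n w.symm (aux_symm n w hw) (w b + 1) h2.2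
    have h6 := hmax (w.symm (w b + 1))
    simp only [Equiv.apply_symm_apply] at h6
    have h7 : w b + 1 = w i := by omega
    rw [h7, Equiv.symm_apply_apply] at h4
    omega
  · simp only [Rothe, Set.mem_setOf_eq, Finset.mem_Icc]
    rintro ⟨h1, h2, h3, h4⟩
    omega
  · unfold code
    apply Finset.card_le_card
    intro a ha
    simp only [Finset.mem_filter, Finset.mem_Ioc] at ha ⊢
    have h1 := hmax a ha
    refine ⟨⟨?_, ha.1.2⟩, h1⟩
    by_contra h
    exact hmin a (by omega) ⟨ha.1.1, h1⟩

theorem shape_parts_of_vexillary (n : ℕ) (w : Equiv.Perm ℕ)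
    (hw : IsPermOn n w) (hvex : Vexillary n w)
    (s : ℕ) (e : ℕ → ℕ × ℕ)
    (hchain : ∀ p q, 1 ≤ p → p < q → q ≤ s → SwneLt (e p) (e q))
    (hrange : Ess (Rothe n w) = {x | ∃ p, 1 ≤ p ∧ p ≤ s ∧ e p = x})
    (k : ℕ → ℕ) (hk0 : k 0 = 0)
    (hk : ∀ p, 1 ≤ p → p ≤ s → k p = (e p).2 - rankUL w (e p).1 (e p).2) :
    ∀ p m, 1 ≤ p → p ≤ s → k (p - 1) < m → m ≤ k p →
      shape n w m = shape n w (k p) ∧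
      shape n w (k p) = (e p).1 - rankUL w (e p).1 (e p).2 := by
  have hD : ∀ p, 1 ≤ p → p ≤ s → e p ∈ Rothe n w := by
    intro p h1 h2
    have : e p ∈ Ess (Rothe n w) := by rw [hrange]; exact ⟨p, h1, h2, rfl⟩
    exact this.1
  have hk' : ∀ p, 1 ≤ p → p ≤ s →
      k p = ((Finset.Ioc (e p).1 n).filter fun a => w a ≤ (e p).2).card := by
    intro p h1 h2
    have h := hD p h1 h2
    simp only [Rothe, Set.mem_setOf_eq, Finset.mem_Icc] at h
    rw [hk p h1 h2, aux_K n w hw _ _ h.1.2 h.2.1.2]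
  have hmono : ∀ p q, 1 ≤ p → p ≤ q → q ≤ s → Swne (e p) (e q) := by
    intro p q h1 h2 h3
    rcases Nat.lt_or_ge p q with h | h
    · exact (hchain p q h1 h h3).1
    · have : p = q := by omega
      subst this
      exact ⟨le_rfl, le_rfl⟩
  have hkm : ∀ p q, 1 ≤ p → p ≤ q → q ≤ s → k p ≤ k q := by
    intro p q h1 h2 h3
    rw [hk' p h1 (by omega), hk' q (by omega) h3]
    obtain ⟨h4, h5⟩ := hmono p q h1 h2 h3
    apply Finset.card_le_card
    intro a
    simp only [Finset.mem_filter, Finset.mem_Ioc]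
    omega
  have key : ∀ p m, 1 ≤ p → p ≤ s → k (p - 1) < m → m ≤ k p →
      shape n w m = (e p).1 - rankUL w (e p).1 (e p).2 := by
    intro p m h1 h2 h3 h4
    rw [← aux_R n w hw]
    unfold shape
    congr 1
    ext i
    simp only [Finset.mem_filter, Finset.mem_Icc]
    constructor
    · rintro ⟨⟨hi1, hi2⟩, hc⟩
      obtain ⟨x, hx, hx1, hx2, hx3⟩ := aux_ess n w hw i hi1 hi2 (by omega)
      rw [hrange] at hx
      obtain ⟨q, hq1, hq2, rfl⟩ := hx
      rw [← hk' q hq1 hq2] at hx3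
      have hpq : p ≤ q := by
        by_contra h
        have := hkm q (p - 1) hq1 (by omega) (by omega)
        omega
      obtain ⟨h5, h6⟩ := hmono p q h1 hpq hq2
      omega
    · rintro ⟨⟨hi1, hi2⟩, hc⟩
      have h := hD p h1 h2
      simp only [Rothe, Set.mem_setOf_eq, Finset.mem_Icc] at h
      refine ⟨⟨hi1, by omega⟩, h4.trans ?_⟩
      rw [hk' p h1 h2]
      unfold code
      apply Finset.card_le_card
      intro a
      simp only [Finset.mem_filter, Finset.mem_Ioc]
      omega
  intro p m h1 h2 h3 h4
  have a1 := key p m h1 h2 h3 h4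
  have a2 := key p (k p) h1 h2 (by omega) le_rfl
  exact ⟨a1.trans a2.symm, a2⟩
end UGS
end

section
/- Let w ∈ S_n be vexillary, write Ess(D(w)) = {(i_1,j_1) ⊏ ⋯ ⊏ (i_s,j_s)}, set k_p = j_p − rank w_{[i_p][j_p]} for p ∈ [s] and k_0 = 0. If p > 1 and (i_p, j_p − 1) ∉ D(w), then k_p = k_{p−1} + 1. -/
open Classical

namespace UGS

theorem kcount (w : Equiv.Perm ℕ) (h0 : w 0 = 0) (i j : ℕ) :
    j - rankUL w i j = ((Finset.Icc 1 j).filter fun c => i < w.symm c).card := by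
  have h1 : rankUL w i j = ((Finset.Icc 1 j).filter fun c => ¬ (i < w.symm c)).card := by
    unfold rankUL
    refine Finset.card_bij (fun a _ => w a) ?_ ?_ ?_
    · intro a ha
      simp only [Finset.mem_filter, Finset.mem_Icc] at ha ⊢
      simp
      omega
    · intro a _ b _ h
      exact w.injective h
    · intro c hc
      simp only [Finset.mem_filter, Finset.mem_Icc] at hc
      refine ⟨w.symm c, ?_, by simp⟩
      have : w.symm c ≠ 0 := by
        intro h
        rw [Equiv.symm_apply_eq] at h
        omega
      simp only [Finset.mem_filter, Finset.mem_Icc, Equiv.apply_symm_apply]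
      omega
  have h2 := Finset.card_filter_add_card_filter_not (s := Finset.Icc 1 j) (fun c => i < w.symm c)
  simp only [Nat.card_Icc] at h2
  omega

theorem stop_of (P : ℕ → Prop) (a N : ℕ) (ha : P a) (hN : ∀ b, P b → b ≤ N) :
    ∃ b, a ≤ b ∧ P b ∧ ¬ P (b + 1) := by
  by_contra hc
  push Not at hc
  have : ∀ t, P (a + t) := by
    intro t
    induction t with
    | zero => exact ha
    | succ t ih => exact hc (a + t) (Nat.le_add_right a t) ih
  have := hN _ (this (N + 1))
  omega

theorem k_step_of_vexillary (n : ℕ) (w : Equiv.Perm ℕ)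
    (hw : IsPermOn n w) (hvex : Vexillary n w)
    (s : ℕ) (e : ℕ → ℕ × ℕ)
    (hchain : ∀ p q, 1 ≤ p → p < q → q ≤ s → SwneLt (e p) (e q))
    (hrange : Ess (Rothe n w) = {x | ∃ p, 1 ≤ p ∧ p ≤ s ∧ e p = x})
    (k : ℕ → ℕ) (hk0 : k 0 = 0)
    (hk : ∀ p, 1 ≤ p → p ≤ s → k p = (e p).2 - rankUL w (e p).1 (e p).2) :
    ∀ p, 2 ≤ p → p ≤ s → ((e p).1, (e p).2 - 1) ∉ Rothe n w →
      k p = k (p - 1) + 1 := by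
  have h0 : w 0 = 0 := hw 0 (by simp)
  have hs : ∀ c, c ∈ Finset.Icc 1 n → w.symm c ∈ Finset.Icc 1 n := by
    intro c hc
    by_contra h
    have := hw _ h
    rw [Equiv.apply_symm_apply] at this
    rw [← this] at h
    exact h hc
  intro p hp2 hps hnot
  have hmem : ∀ q, 1 ≤ q → q ≤ s → e q ∈ Ess (Rothe n w) := by
    intro q h1 h2
    rw [hrange]
    exact ⟨q, h1, h2, rfl⟩
  have hp := hmem p (by omega) hps
  have hq := hmem (p - 1) (by omega) (by omega)
  have hpq := hchain (p - 1) p (by omega) (by omega) hps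
  rw [hk p (by omega) hps, hk (p - 1) (by omega) (by omega), kcount w h0, kcount w h0]
  have hess : ∀ a b, (a, b) ∈ Ess (Rothe n w) → b < (e p).2 →
      (e (p - 1)).1 ≤ a ∧ b ≤ (e (p - 1)).2 := by
    intro a b hab hb
    rw [hrange] at hab
    obtain ⟨q, h1, h2, h3⟩ := hab
    rcases lt_trichotomy q p with h | h | h
    · rcases Nat.lt_or_ge q (p - 1) with h' | h'
      · have := (hchain q (p - 1) h1 h' (by omega)).1
        rw [h3] at this
        exact this
      · have : q = p - 1 := by omega
        subst this
        rw [h3]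
        exact ⟨le_rfl, le_rfl⟩
    · subst h
      rw [h3] at hb
      exact absurd hb (lt_irrefl _)
    · have := (hchain p q (by omega) h h2).1.2
      rw [h3] at this
      simp only at this
      omega
  generalize e p = x at *
  generalize e (p - 1) = y at *
  obtain ⟨i, j⟩ := x
  obtain ⟨i', j'⟩ := y
  obtain ⟨⟨hle1, hle2⟩, hne⟩ := hpq
  simp only [Ess, Rothe, Set.mem_ofPred_eq, Finset.mem_Icc] at hp hq hnot hle1 hle2 hess hs ⊢
  obtain ⟨⟨hi, hj, hjw, hiw⟩, hp1, hp2⟩ := hp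
  obtain ⟨⟨hi', hj', hjw', hiw'⟩, hq1, hq2⟩ := hq
  have hsj := hs j hj
  have hsj' := hs j' hj'
  have hwi1 : w (i + 1) ≤ j := by
    by_contra h
    have : ¬ (i + 1 < w.symm j) := fun h' => hp2 ⟨by omega, hj, by omega, h'⟩
    have h2 : w.symm j = i + 1 := by omega
    rw [Equiv.symm_apply_eq] at h2
    omega
  have hwpos : ∀ a, 1 ≤ a → 1 ≤ w a := by
    intro a ha
    by_contra h
    have : w a = w 0 := by omega
    have := w.injective this
    omega
  have hjm : 1 < j → w.symm (j - 1) ≤ i := by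
    intro h
    by_contra h'
    exact hnot ⟨hi, by omega, by omega, by omega⟩
  have hlt : j' < j := by
    by_contra h
    have hjj : j' = j := by omega
    subst hjj
    have hii : i < i' := by
      rcases Nat.lt_or_ge i i' with h | h
      · exact h
      · exact absurd (by rw [show i = i' by omega]) hne
    have hne1 : w (i + 1) ≠ j' := by
      intro h
      rw [← Equiv.eq_symm_apply] at h
      omega
    have := hwpos (i + 1) (by omega)
    have hm := hjm (by omega)
    have hm0 := hs (j' - 1) (by omega)
    have hne2 : w (i + 1) ≠ j' - 1 := by
      intro h
      rw [← Equiv.eq_symm_apply] at h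
      omega
    have hne3 : i + 1 ≠ i' := by
      intro h
      rw [h] at hwi1
      omega
    refine hvex ⟨w.symm (j' - 1), i + 1, i', w.symm j', by omega, by omega, by omega, by omega,
      by omega, ?_⟩
    simp only [Equiv.apply_symm_apply]
    omega
  have key : ∀ c, 1 ≤ c → c < j → i < w.symm c → c ≤ j' ∧ i' < w.symm c := by
    intro c hc1 hcj hic
    have hm := hjm (by omega)
    have hsc := hs c (by omega)
    have hcne : c ≠ j - 1 := by
      intro h
      rw [h] at hic
      omega
    obtain ⟨a, ha1, ⟨ha2, ha3⟩, ha4⟩ := stop_of (fun a => c < w a ∧ a < w.symm c) i n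
      ⟨by omega, hic⟩ (fun b hb => by omega)
    obtain ⟨b, hb1, ⟨hb2, hb3, hb4⟩, hb5⟩ := stop_of
      (fun b => b < w a ∧ a < w.symm b ∧ b < j - 1) c n ⟨ha2, ha3, by omega⟩ (fun b hb => by omega)
    have hwa : w (a + 1) ≤ c := by
      by_contra h
      have : ¬ (a + 1 < w.symm c) := fun h' => ha4 ⟨by omega, h'⟩
      have h2 : w.symm c = a + 1 := by omega
      rw [Equiv.symm_apply_eq] at h2
      omega
    have := hess a b ⟨⟨by omega, by omega, hb2, hb3⟩, ?_, ?_⟩ (by omega)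
    · omega
    · rintro ⟨-, -, h1, h2⟩
      refine hb5 ⟨h1, h2, ?_⟩
      by_contra h
      have : b + 1 = j - 1 := by omega
      rw [this] at h2
      omega
    · rintro ⟨-, -, h1, h2⟩
      omega
  rw [← Finset.card_insert_of_notMem (a := j)]
  · congr 1
    ext c
    simp only [Finset.mem_filter, Finset.mem_insert, Finset.mem_Icc]
    constructor
    · rintro ⟨⟨h1, h2⟩, h3⟩
      rcases Nat.lt_or_ge c j with h | h
      · have := key c h1 h h3
        right
        omega
      · left
        omega
    · rintro (h | ⟨⟨h1, h2⟩, h3⟩)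
      · subst h
        exact ⟨⟨hj.1, le_rfl⟩, hiw⟩
      · omega
  · simp only [Finset.mem_filter, Finset.mem_Icc]
    omega
end UGS
end

section
/- An involution y ∈ S_n is vexillary if and only if Ess(D^O(y)) is a chain under the southwest-to-northeast order ⊑, where D^O(y) = D(y) ∩ {(i,j) : i ≥ j}. -/
open Classical

namespace UGS

/-- `D^O(y) = D(y) ∩ {(i,j) : i ≥ j}`. -/
def DO (n : ℕ) (y : Equiv.Perm ℕ) : Set (ℕ × ℕ) :=
  Rothe n y ∩ {p | p.2 ≤ p.1}

/-- `D^Sp(y) = D(y) ∩ {(i,j) : i > j}`. -/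
def DSp (n : ℕ) (y : Equiv.Perm ℕ) : Set (ℕ × ℕ) :=
  Rothe n y ∩ {p | p.2 < p.1}

/-- `c^O_i(y) = #{j ∈ [i] : y(i) > j, y(j) > i}`. -/
def codeO (y : Equiv.Perm ℕ) (i : ℕ) : ℕ :=
  ((Finset.Icc 1 i).filter fun j => j < y i ∧ i < y j).card

/-- `c^Sp_i(y) = #{j ∈ [i-1] : y(i) > j, y(j) > i}`. -/
def codeSp (y : Equiv.Perm ℕ) (i : ℕ) : ℕ :=
  ((Finset.Ico 1 i).filter fun j => j < y i ∧ i < y j).card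

/-- `sh^O(y)_k = #{i ∈ [n] : c^O_i(y) ≥ k}`. -/
def shapeO (n : ℕ) (y : Equiv.Perm ℕ) (k : ℕ) : ℕ :=
  ((Finset.Icc 1 n).filter fun i => k ≤ codeO y i).card

/-- `sh^Sp(y)_k = #{i ∈ [n] : c^Sp_i(y) ≥ k}`. -/
def shapeSp (n : ℕ) (y : Equiv.Perm ℕ) (k : ℕ) : ℕ :=
  ((Finset.Icc 1 n).filter fun i => k ≤ codeSp y i).card

def EE (n : ℕ) (y : Equiv.Perm ℕ) (a b : ℕ) : Prop :=
  1 ≤ a ∧ a ≤ n ∧ 1 ≤ b ∧ b ≤ n ∧ b < y a ∧ a < y b ∧ y (a+1) ≤ b ∧ y (b+1) ≤ a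

theorem EE_symm {n : ℕ} {y : Equiv.Perm ℕ} {a b : ℕ} (h : EE n y a b) : EE n y b a := by
  unfold EE at *; tauto

theorem y_le {n : ℕ} {y : Equiv.Perm ℕ} (hy : IsPermOn n y) (hinv : Function.Involutive ⇑y)
    {a : ℕ} (ha : a ≤ n) : y a ≤ n := by
  by_contra h
  have h1 := hy (y a) (by simp; omega)
  rw [hinv a] at h1
  omega

theorem y_pos {n : ℕ} {y : Equiv.Perm ℕ} (hy : IsPermOn n y) (hinv : Function.Involutive ⇑y)
    {a : ℕ} (ha : 1 ≤ a) : 1 ≤ y a := by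
  by_contra h
  have h0 : y a = 0 := by omega
  have h1 := hy 0 (by simp)
  have h2 := hinv a
  rw [h0, h1] at h2
  omega

theorem step {y : Equiv.Perm ℕ} (hinv : Function.Involutive ⇑y) {a b : ℕ}
    (h2 : a < y b) (h : ¬ (b < y (a+1) ∧ a + 1 < y b)) : y (a+1) ≤ b := by
  by_contra h3
  have h4 : y b = a + 1 := by
    by_contra h5
    exact h ⟨by omega, by omega⟩
  have h5 := hinv b
  rw [h4] at h5
  omega

theorem y_symm {y : Equiv.Perm ℕ} (hinv : Function.Involutive ⇑y) (a : ℕ) : y.symm a = y a := by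
  rw [Equiv.symm_apply_eq, hinv a]

theorem mem_ess {n : ℕ} {y : Equiv.Perm ℕ} (hy : IsPermOn n y) (hinv : Function.Involutive ⇑y)
    (p : ℕ × ℕ) : p ∈ Ess (DO n y) ↔ EE n y p.1 p.2 ∧ p.2 ≤ p.1 := by
  obtain ⟨a, b⟩ := p
  simp only [Ess, DO, Rothe, Set.mem_setOf_eq, Set.mem_inter_iff, Finset.mem_Icc, y_symm hinv, EE]
  constructor
  · rintro ⟨⟨⟨⟨h1, h2⟩, ⟨h3, h4⟩, h5, h6⟩, h7⟩, h8, h9⟩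
    have hd : y (a+1) ≤ b := by
      apply step hinv h6
      rintro ⟨g1, g2⟩
      have := y_le hy hinv h4
      exact h9 ⟨⟨⟨by omega, by omega⟩, ⟨h3, h4⟩, g1, g2⟩, by omega⟩
    refine ⟨⟨h1, h2, h3, h4, h5, h6, hd, ?_⟩, h7⟩
    rcases Nat.lt_or_ge b a with hlt | hge
    · apply step hinv h5
      rintro ⟨g1, g2⟩
      have := y_le hy hinv h2
      exact h8 ⟨⟨⟨h1, h2⟩, ⟨by omega, by omega⟩, g2, g1⟩, by omega⟩
    · have : a = b := by omega
      subst this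
      exact hd
  · rintro ⟨⟨h1, h2, h3, h4, h5, h6, h7, h8⟩, h9⟩
    refine ⟨⟨⟨⟨h1, h2⟩, ⟨h3, h4⟩, h5, h6⟩, h9⟩, ?_, ?_⟩
    · rintro ⟨⟨_, _, _, g⟩, _⟩
      omega
    · rintro ⟨⟨_, _, g, _⟩, _⟩
      omega

theorem exists_EE {n : ℕ} {y : Equiv.Perm ℕ} (hinv : Function.Involutive ⇑y)
    {i J m M : ℕ} (hi : 1 ≤ i) (hm : 1 ≤ m) (hiJ : i < J) (hmM : m < M)
    (hJn : J ≤ n + 1) (hMn : M ≤ n + 1)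
    (h1 : m < y i) (h2 : i < y m)
    (hJ : ∀ c, m ≤ c → ¬ (c < y J ∧ J < y c))
    (hM : ∀ r, i ≤ r → ¬ (M < y r ∧ r < y M)) :
    ∃ a b, EE n y a b ∧ a < J ∧ b < M ∧ i ≤ a ∧ m ≤ b := by
  obtain ⟨⟨a, b⟩, hp, hmax⟩ := Finset.exists_max_image
    ((Finset.Ico i J ×ˢ Finset.Ico m M).filter fun p => p.2 < y p.1 ∧ p.1 < y p.2)
    (fun p => p.1 + p.2) ⟨(i, m), by simp; omega⟩
  simp only [Finset.mem_filter, Finset.mem_product, Finset.mem_Ico] at hp hmax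
  obtain ⟨⟨⟨p1, p2⟩, p3, p4⟩, p5, p6⟩ := hp
  refine ⟨a, b, ⟨by omega, by omega, by omega, by omega, p5, p6, ?_, ?_⟩, p2, p4, p1, p3⟩
  · apply step hinv p6
    rintro ⟨g1, g2⟩
    by_cases h : a + 1 = J
    · subst h
      exact hJ b p3 ⟨g1, g2⟩
    · have := hmax (a+1, b) ⟨⟨⟨by simp; omega, by simp; omega⟩, p3, p4⟩, g1, g2⟩
      simp at this
  · apply step hinv p5
    rintro ⟨g1, g2⟩
    by_cases h : b + 1 = M
    · subst h
      exact hM a p1 ⟨g2, g1⟩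
    · have := hmax (a, b+1) ⟨⟨⟨p1, p2⟩, by simp; omega, by simp; omega⟩, g2, g1⟩
      simp at this

theorem EE_maxmin {n : ℕ} {y : Equiv.Perm ℕ} {a b : ℕ} (h : EE n y a b) :
    EE n y (max a b) (min a b) := by
  rcases le_total a b with hh | hh
  · rw [max_eq_right hh, min_eq_left hh]
    exact EE_symm h
  · rw [max_eq_left hh, min_eq_right hh]
    exact h

theorem pattern_of_EE {n : ℕ} {y : Equiv.Perm ℕ} (hy : IsPermOn n y)
    (hinv : Function.Involutive ⇑y) {a b c d : ℕ} (h : EE n y a b) (h' : EE n y c d)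
    (hac : a < c) (hbd : b < d) : ¬ Vexillary n y := by
  obtain ⟨h1, h2, h3, h4, h5, h6, h7, h8⟩ := h
  obtain ⟨k1, k2, k3, k4, k5, k6, k7, k8⟩ := h'
  have e1 : c ≠ a + 1 := by
    rintro rfl
    omega
  have e2 : d ≠ b + 1 := by
    rintro rfl
    omega
  intro hv
  apply hv
  have := y_le hy hinv k4
  have := y_pos hy hinv (a := b + 1) (by omega)
  refine ⟨y (b+1), a+1, c, y d, by omega, by omega, by omega, by omega, by omega, ?_, ?_, ?_⟩
  · rw [hinv]; omega
  · rw [hinv, hinv]; omega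
  · rw [hinv]; omega

theorem involution_vexillary_iff_chain (n : ℕ) (y : Equiv.Perm ℕ)
    (hy : IsPermOn n y) (hinv : Function.Involutive ⇑y) :
    Vexillary n y ↔ IsSwneChain (Ess (DO n y)) := by
  constructor
  · intro hv p hp q hq
    rw [mem_ess hy hinv] at hp hq
    by_contra hcon
    unfold Swne at hcon
    have : (p.1 < q.1 ∧ p.2 < q.2) ∨ (q.1 < p.1 ∧ q.2 < p.2) := by omega
    rcases this with ⟨u, v⟩ | ⟨u, v⟩
    · exact pattern_of_EE hy hinv hp.1 hq.1 u v hv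
    · exact pattern_of_EE hy hinv hq.1 hp.1 u v hv
  · rintro hc ⟨i, j, k, l, h1, hij, hjk, hkl, hln, w1, w2, w3⟩
    have yj := y_pos hy hinv (a := j) (by omega)
    have yl := y_le hy hinv hln
    have yi := y_le hy hinv (a := i) (by omega)
    have yn : y (n+1) = n+1 := hy _ (by simp)
    obtain ⟨a, b, hE, ha, hb, -, -⟩ := exists_EE (n := n) hinv (i := i) (J := j) (m := y j)
      (M := y i) h1 yj hij w1 (by omega) (by omega) w1 (by rw [hinv]; exact hij)
      (by intro c hc; omega) (by intro r hr; rw [hinv]; omega)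
    obtain ⟨c, d, hE', -, -, hc', hd'⟩ := exists_EE (n := n) hinv (i := k) (J := n+1) (m := y l)
      (M := n+1) (by omega) (by omega) (by omega) (by omega) le_rfl le_rfl w3
      (by rw [hinv]; exact hkl)
      (by
        rw [yn]
        rintro c - ⟨g1, g2⟩
        have := y_le hy hinv (a := c) (by omega)
        omega)
      (by
        rw [yn]
        rintro c - ⟨g1, g2⟩
        have := y_le hy hinv (a := c) (by omega)
        omega)
    have := hc (max a b, min a b) ((mem_ess hy hinv _).2 ⟨EE_maxmin hE, by simp⟩)
      (max c d, min c d) ((mem_ess hy hinv _).2 ⟨EE_maxmin hE', by simp⟩)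
    unfold Swne at this
    simp only at this
    omega
end UGS
end

section
/- Let y ∈ S_n be a vexillary involution that is not the identity, and let j' be the largest column index j such that (i,j) ∈ Ess(D^O(y)) for some i. Then for every i ∈ [n]: c^O_i(y) = #{j ∈ [i] : y(j) ≠ j} if i ≤ j', and c^O_i(y) = c_i(y) if i > j'; likewise c^Sp_i(y) = #{j ∈ [i−1] : y(j) ≠ j} if i ≤ j', and c^Sp_i(y) = c_i(y) if i > j'. -/
open Classical

namespace UGS

theorem exists_ess_s5 (n : ℕ) (D : Set (ℕ × ℕ)) (hD : ∀ p ∈ D, p.1 ≤ n ∧ p.2 ≤ n) :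
    ∀ (m : ℕ) (p : ℕ × ℕ), p ∈ D → 2 * n - p.1 - p.2 ≤ m → ∃ q ∈ Ess D, p.2 ≤ q.2 := by
  intro m
  induction m with
  | zero =>
    intro p hp hm
    refine ⟨p, ⟨hp, fun h => ?_, fun h => ?_⟩, le_rfl⟩
    · have h1 := hD _ hp
      have h2 := hD _ h
      simp only at h2
      omega
    · have h1 := hD _ hp
      have h2 := hD _ h
      simp only at h2
      omega
  | succ m ih =>
    intro p hp hm
    have h1 := hD _ hp
    by_cases ha : (p.1, p.2 + 1) ∈ D
    · obtain ⟨q, hq, hle⟩ := ih _ ha (by simp only; omega)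
      exact ⟨q, hq, by simp only at hle; omega⟩
    by_cases hb : (p.1 + 1, p.2) ∈ D
    · obtain ⟨q, hq, hle⟩ := ih _ hb (by simp only; omega)
      exact ⟨q, hq, hle⟩
    exact ⟨p, ⟨hp, ha, hb⟩, le_rfl⟩

theorem vexillary_involution_codes (n : ℕ) (y : Equiv.Perm ℕ)
    (hy : IsPermOn n y) (hinv : Function.Involutive ⇑y) (hvex : Vexillary n y)
    (hne : ∃ i, 1 ≤ i ∧ i ≤ n ∧ y i ≠ i)
    (j' : ℕ) (hj'mem : ∃ i, (i, j') ∈ Ess (DO n y))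
    (hj'max : ∀ p ∈ Ess (DO n y), p.2 ≤ j') :
    ∀ i, 1 ≤ i → i ≤ n →
      (i ≤ j' → codeO y i = ((Finset.Icc 1 i).filter fun j => y j ≠ j).card) ∧
      (j' < i → codeO y i = code n y i) ∧
      (i ≤ j' → codeSp y i = ((Finset.Ico 1 i).filter fun j => y j ≠ j).card) ∧
      (j' < i → codeSp y i = code n y i) := by
  intro i hi1 hin
  have hsymm : ∀ a, y.symm a = y a := fun a => by
    rw [Equiv.symm_apply_eq]; exact (hinv a).symm
  have hrange : ∀ a, 1 ≤ a → a ≤ n → 1 ≤ y a ∧ y a ≤ n := by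
    intro a h1 h2
    by_contra hc
    have h3 := hy (y a) (by rw [Finset.mem_Icc]; exact hc)
    rw [hinv a] at h3
    rw [← h3] at hc
    exact hc ⟨h1, h2⟩
  have hA : ∀ j, 1 ≤ j → j ≤ j' → y j ≠ j → j' < y j := by
    obtain ⟨i0, ⟨⟨h1, h2, h3, h4⟩, h5⟩, -⟩ := hj'mem
    simp only [Set.mem_setOf_eq, Finset.mem_Icc, hsymm] at h1 h2 h3 h4 h5
    have key : ∀ a b, 1 ≤ a → a < b → b ≤ j' → y a = b → False := by
      intro a b ha hab hb hyab
      have hyb : y b = a := by rw [← hyab]; exact hinv a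
      have hbj : b ≠ j' := by rintro rfl; omega
      have hr := hrange j' h2.1 h2.2
      have hi := hinv j'
      exact hvex ⟨a, b, j', y j', ha, hab, by omega, by omega, hr.2,
        by omega, by omega, by omega⟩
    intro j hj1 hj2 hne'
    by_contra hlt
    have hr := hrange j hj1 (by omega)
    rcases lt_or_gt_of_ne hne' with h | h
    · exact key (y j) j hr.1 h hj2 (hinv j)
    · exact key j (y j) hj1 h (by omega) rfl
  have hB : ∀ k, j' < i → i < k → k ≤ n → y k < y i → y k < i := by
    intro k hji hik hkn hlt
    by_contra hc
    have hr := hrange k (by omega) hkn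
    have hmem : (y k, i) ∈ DO n y := by
      refine ⟨⟨?_, ?_, ?_, ?_⟩, ?_⟩
      · simpa using hr
      · simpa using ⟨hi1, hin⟩
      · simpa [hinv k] using hik
      · simpa [hsymm] using hlt
      · simpa using hc
    obtain ⟨q, hq, hle⟩ := exists_ess_s5 n (DO n y)
      (fun p hp => ⟨(Finset.mem_Icc.1 hp.1.1).2, (Finset.mem_Icc.1 hp.1.2.1).2⟩) _ _ hmem le_rfl
    have := hj'max q hq
    simp only at hle
    omega
  refine ⟨fun h => ?_, fun h => ?_, fun h => ?_, fun h => ?_⟩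
  · unfold codeO
    congr 1
    ext j
    simp only [Finset.mem_filter, Finset.mem_Icc]
    constructor
    · rintro ⟨h1, h2, h3⟩; exact ⟨h1, by omega⟩
    · rintro ⟨h1, h2⟩
      have a1 := hA j h1.1 (by omega) h2
      refine ⟨h1, ?_, by omega⟩
      by_cases hf : y i = i
      · have : j ≠ i := by rintro rfl; exact h2 hf
        omega
      · have := hA i hi1 h hf
        omega
  · unfold codeO code
    refine Finset.card_nbij' y y ?_ ?_ (fun a _ => hinv a) (fun a _ => hinv a)
    · intro j hj
      simp only [Finset.coe_filter, Finset.mem_Icc, Finset.mem_Ioc, Set.mem_setOf_eq, hinv j] at hj ⊢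
      have := hrange j hj.1.1 (by omega)
      omega
    · intro k hk
      simp only [Finset.coe_filter, Finset.mem_Icc, Finset.mem_Ioc, Set.mem_setOf_eq, hinv k] at hk ⊢
      have := hrange k (by omega) hk.1.2
      have := hB k h hk.1.1 hk.1.2 hk.2
      omega
  · unfold codeSp
    congr 1
    ext j
    simp only [Finset.mem_filter, Finset.mem_Ico]
    constructor
    · rintro ⟨h1, h2, h3⟩; exact ⟨h1, by omega⟩
    · rintro ⟨h1, h2⟩
      have a1 := hA j h1.1 (by omega) h2
      refine ⟨h1, ?_, by omega⟩
      by_cases hf : y i = i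
      · omega
      · have := hA i hi1 h hf
        omega
  · unfold codeSp code
    refine Finset.card_nbij' y y ?_ ?_ (fun a _ => hinv a) (fun a _ => hinv a)
    · intro j hj
      simp only [Finset.coe_filter, Finset.mem_Ico, Finset.mem_Ioc, Set.mem_setOf_eq, hinv j] at hj ⊢
      have := hrange j hj.1.1 (by omega)
      omega
    · intro k hk
      simp only [Finset.coe_filter, Finset.mem_Ico, Finset.mem_Ioc, Set.mem_setOf_eq, hinv k] at hk ⊢
      have := hrange k (by omega) hk.1.2
      have := hB k h hk.1.1 hk.1.2 hk.2
      omega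
end UGS
end

section
/- Let y ∈ S_n be a vexillary involution, write Ess(D^O(y)) = {(i_1,j_1) ⊏ ⋯ ⊏ (i_s,j_s)} (a chain under the southwest-to-northeast order), and set k_p = j_p − rank y_{[i_p][j_p]} for p ∈ [s] (with k_s := 0 when s = 0). Then {c^O_1(y),…,c^O_n(y)} \ {0} = {1,2,…,k_s}, and for every k ∈ {1,…,k_s} \ {k_1,…,k_s} there is exactly one i ∈ [n] with c^O_i(y) = k. -/
open Classical

namespace UGS

/-- number of `a ∈ [j]` with `y a > i`. -/
def NN (y : Equiv.Perm ℕ) (i j : ℕ) : ℕ := ((Finset.Icc 1 j).filter fun a => i < y a).card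

theorem mem_DO_iff (n : ℕ) (y : Equiv.Perm ℕ) (hy : IsPermOn n y)
    (hinv : Function.Involutive ⇑y) (i j : ℕ) :
    (i, j) ∈ DO n y ↔ 1 ≤ j ∧ j ≤ i ∧ j < y i ∧ i < y j := by
  have hs : y.symm j = y j := by rw [Equiv.symm_apply_eq]; exact (hinv j).symm
  simp only [DO, Rothe, Set.mem_inter_iff, Set.mem_ofPred_eq, Finset.mem_Icc, hs]
  constructor
  · rintro ⟨⟨h1, h2, h3, h4⟩, h5⟩
    exact ⟨h2.1, h5, h3, h4⟩
  · rintro ⟨h1, h2, h3, h4⟩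
    have hj := hy (y j)
    rw [hinv j, Finset.mem_Icc] at hj
    have : y j ≤ n := by
      by_contra hc
      have := hj (by omega)
      omega
    exact ⟨⟨⟨by omega, by omega⟩, ⟨h1, by omega⟩, h3, h4⟩, h2⟩

theorem NN_eq (n : ℕ) (y : Equiv.Perm ℕ) (hy : IsPermOn n y)
    (hinv : Function.Involutive ⇑y) (i j : ℕ) : j - rankUL y i j = NN y i j := by
  have hpos : ∀ a, 1 ≤ a → 1 ≤ y a := by
    intro a ha
    by_contra hc
    have h0 : y a = 0 := by omega
    have h1 := hy 0 (by simp)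
    have h2 := hinv a
    rw [h0, h1] at h2
    omega
  have h1 : rankUL y i j = ((Finset.Icc 1 j).filter fun a => ¬ (i < y a)).card := by
    unfold rankUL
    apply Finset.card_bij (fun a _ => y a)
    · intro a ha
      simp only [Finset.mem_filter, Finset.mem_Icc] at ha ⊢
      rw [hinv a]; omega
    · intro a _ b _ h
      exact y.injective h
    · intro b hb
      simp only [Finset.mem_filter, Finset.mem_Icc] at hb
      refine ⟨y b, ?_, hinv b⟩
      have := hpos b hb.1.1
      simp only [Finset.mem_filter, Finset.mem_Icc]
      rw [hinv b]; omega
  have h2 := Finset.card_filter_add_card_filter_not (s := Finset.Icc 1 j) (fun a => i < y a)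
  rw [Nat.card_Icc] at h2
  unfold NN
  omega

theorem descend (n : ℕ) (y : Equiv.Perm ℕ) (hy : IsPermOn n y)
    (hinv : Function.Involutive ⇑y) (i j : ℕ) (h : (i, j) ∈ DO n y)
    (hr : ∀ i', i ≤ i' → (i', j + 1) ∉ DO n y) :
    ∃ i', (i', j) ∈ Ess (DO n y) ∧ NN y i' j = NN y i j := by
  -- induct on y j - i
  obtain ⟨d, hd⟩ : ∃ d, y j - i = d := ⟨_, rfl⟩
  induction d generalizing i with
  | zero =>
    rw [mem_DO_iff n y hy hinv] at h
    omega
  | succ d ih =>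
    by_cases hn : (i + 1, j) ∈ DO n y
    · obtain ⟨i', h1, h2⟩ := ih (i + 1) hn (fun i' hi' => hr i' (by omega)) (by omega)
      refine ⟨i', h1, h2.trans ?_⟩
      unfold NN
      congr 1
      apply Finset.filter_congr
      intro a ha
      rw [Finset.mem_Icc] at ha
      rw [mem_DO_iff n y hy hinv] at hn
      have hne : y a ≠ i + 1 := by
        intro hc
        have := hinv a
        rw [hc] at this
        omega
      omega
    · exact ⟨i, ⟨h, hr i le_rfl, hn⟩, rfl⟩

theorem NN_le_count (n : ℕ) (y : Equiv.Perm ℕ) (hy : IsPermOn n y)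
    (i j : ℕ) (hij : j ≤ i) : NN y i j ≤ Nat.count (fun a => a < y a) (n + 1) := by
  rw [Nat.count_eq_card_filter_range]
  apply Finset.card_le_card
  intro a ha
  simp only [Finset.mem_filter, Finset.mem_Icc, Finset.mem_range] at ha ⊢
  refine ⟨?_, by omega⟩
  by_contra hc
  have := hy a (by rw [Finset.mem_Icc]; omega)
  omega

theorem codeO_le (y : Equiv.Perm ℕ) (i : ℕ) : codeO y i ≤ NN y i i := by
  apply Finset.card_le_card
  intro a ha
  simp only [Finset.mem_filter, Finset.mem_Icc] at ha ⊢
  omega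

theorem codeO_opener (n : ℕ) (y : Equiv.Perm ℕ) (hy : IsPermOn n y)
    (hinv : Function.Involutive ⇑y) (hvex : Vexillary n y) (i : ℕ) (hi : i < y i) :
    codeO y i = Nat.count (fun a => a < y a) (i + 1) ∧ NN y i i = codeO y i := by
  have hin : 1 ≤ i ∧ y i ≤ n := by
    have h1 := hy i
    have h2 := hy (y i)
    rw [hinv i] at h2
    rw [Finset.mem_Icc] at h1 h2
    constructor
    · by_contra hc
      have := h1 (by omega)
      omega
    · by_contra hc
      have := h2 (by omega)
      omega
  constructor
  · rw [Nat.count_eq_card_filter_range]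
    unfold codeO
    congr 1
    ext a
    simp only [Finset.mem_filter, Finset.mem_Icc, Finset.mem_range]
    constructor
    · rintro h
      omega
    · rintro ⟨h1, h2⟩
      have ha : 1 ≤ a := by
        by_contra hc
        have := hy a (by rw [Finset.mem_Icc]; omega)
        omega
      refine ⟨by omega, by omega, ?_⟩
      by_contra hc
      have hne : y a ≠ i := by
        intro h
        have := hinv a
        rw [h] at this
        omega
      apply hvex
      refine ⟨a, y a, i, y i, ha, h2, by omega, hi, hin.2, ?_⟩
      rw [hinv a, hinv i]
      omega
  · unfold NN codeO
    congr 1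
    apply Finset.filter_congr
    intro a ha
    rw [Finset.mem_Icc] at ha
    omega

theorem codeO_closer (n : ℕ) (y : Equiv.Perm ℕ) (hy : IsPermOn n y)
    (hinv : Function.Involutive ⇑y) (i : ℕ) (hi : y i ≤ i) (hpos : 1 ≤ codeO y i) :
    ∃ x ∈ Ess (DO n y), NN y x.1 x.2 = codeO y i := by
  have hne : ((Finset.Icc 1 i).filter fun j => j < y i ∧ i < y j).Nonempty :=
    Finset.card_pos.mp hpos
  obtain ⟨j, hj, hmax⟩ := Finset.exists_max_image _ id hne
  simp only [Finset.mem_filter, Finset.mem_Icc, id] at hj hmax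
  have hmem : (i, j) ∈ DO n y := by rw [mem_DO_iff n y hy hinv]; omega
  obtain ⟨i', h1, h2⟩ := descend n y hy hinv i j hmem (by
    intro i' hi' hc
    rw [mem_DO_iff n y hy hinv] at hc
    by_cases hh : y i = j + 1
    · have := hinv i
      rw [hh] at this
      omega
    · have := hmax (j + 1) (by omega)
      omega)
  refine ⟨(i', j), h1, h2.trans ?_⟩
  unfold NN codeO
  congr 1
  ext a
  simp only [Finset.mem_filter, Finset.mem_Icc]
  constructor
  · intro h
    omega
  · intro h
    have := hmax a h
    omega

theorem involution_code_parts (n : ℕ) (y : Equiv.Perm ℕ)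
    (hy : IsPermOn n y) (hinv : Function.Involutive ⇑y) (hvex : Vexillary n y)
    (s : ℕ) (e : ℕ → ℕ × ℕ)
    (hchain : ∀ p q, 1 ≤ p → p < q → q ≤ s → SwneLt (e p) (e q))
    (hrange : Ess (DO n y) = {x | ∃ p, 1 ≤ p ∧ p ≤ s ∧ e p = x})
    (k : ℕ → ℕ) (hk0 : k 0 = 0)
    (hk : ∀ p, 1 ≤ p → p ≤ s → k p = (e p).2 - rankUL y (e p).1 (e p).2) :
    ({m : ℕ | ∃ i, 1 ≤ i ∧ i ≤ n ∧ codeO y i = m} \ {0} = Set.Icc 1 (k s)) ∧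
    (∀ m, 1 ≤ m → m ≤ k s → (¬ ∃ p, 1 ≤ p ∧ p ≤ s ∧ k p = m) →
      ∃! i : ℕ, 1 ≤ i ∧ i ≤ n ∧ codeO y i = m) := by
  have hkN : ∀ p, 1 ≤ p → p ≤ s → k p = NN y (e p).1 (e p).2 := fun p h1 h2 =>
    (hk p h1 h2).trans (NN_eq n y hy hinv _ _)
  have hEss : ∀ x ∈ Ess (DO n y), ∃ p, 1 ≤ p ∧ p ≤ s ∧ k p = NN y x.1 x.2 := by
    intro x hx
    rw [hrange] at hx
    obtain ⟨p, h1, h2, rfl⟩ := hx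
    exact ⟨p, h1, h2, hkN p h1 h2⟩
  set P : ℕ → Prop := fun a => a < y a with hP
  have hopn : ∀ i, i < y i → 1 ≤ i ∧ i ≤ n := by
    intro i hi
    by_contra hc
    have := hy i (by rw [Finset.mem_Icc]; omega)
    omega
  have hop : ∀ m, 1 ≤ m → m ≤ Nat.count P (n + 1) →
      ∃ i, i < y i ∧ Nat.count P (i + 1) = m := by
    intro m h1
    generalize n + 1 = N
    induction N with
    | zero => intro h; rw [Nat.count_zero] at h; omega
    | succ N ih =>
      intro h
      by_cases hm : m ≤ Nat.count P N
      · exact ih hm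
      · have hc := Nat.count_succ P N
        by_cases hPN : P N
        · rw [if_pos hPN] at hc
          exact ⟨N, hPN, by omega⟩
        · rw [if_neg hPN] at hc
          omega
  have hks : k s = Nat.count P (n + 1) := by
    apply le_antisymm
    · rcases Nat.eq_zero_or_pos s with h0 | h0
      · rw [h0, hk0]; exact Nat.zero_le _
      · rw [hkN s h0 le_rfl]
        have hx : e s ∈ Ess (DO n y) := by rw [hrange]; exact ⟨s, h0, le_rfl, rfl⟩
        have hx1 : ((e s).1, (e s).2) ∈ DO n y := hx.1
        rw [mem_DO_iff n y hy hinv] at hx1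
        exact NN_le_count n y hy _ _ hx1.2.1
    · rcases Nat.eq_zero_or_pos (Nat.count P (n + 1)) with h0 | h0
      · rw [h0]; exact Nat.zero_le _
      · obtain ⟨i, hi, hc⟩ := hop _ h0 le_rfl
        obtain ⟨hc1, hc2⟩ := codeO_opener n y hy hinv hvex i hi
        obtain ⟨i', h1, h2⟩ := descend n y hy hinv i i
          (by rw [mem_DO_iff n y hy hinv]; have := hopn i hi; omega) (by
            intro i' _ hcc
            rw [mem_DO_iff n y hy hinv] at hcc
            have hi1 : P (i + 1) := by show i + 1 < y (i + 1); omega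
            have h3 : Nat.count P (i + 1 + 1) = Nat.count P (i + 1) + 1 := by
              rw [Nat.count_succ, if_pos hi1]
            have h4 : Nat.count P (i + 1 + 1) ≤ Nat.count P (n + 1) :=
              Nat.count_monotone P (by have := hopn (i + 1) hi1; omega)
            omega)
        obtain ⟨p, hp1, hp2, hp3⟩ := hEss _ h1
        have hval : k p = Nat.count P (n + 1) := by
          rw [hp3, h2, hc2, hc1]; exact hc
        rw [← hval]
        rcases Nat.lt_or_ge p s with hps | hps
        · have hsw := (hchain p s hp1 hps le_rfl).1
          rw [hkN p hp1 hp2, hkN s (by omega) le_rfl]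
          apply Finset.card_le_card
          intro a ha
          simp only [Finset.mem_filter, Finset.mem_Icc] at ha ⊢
          unfold Swne at hsw
          omega
        · have : p = s := by omega
          rw [this]
  rw [hks]
  have hex : ∀ m, 1 ≤ m → m ≤ Nat.count P (n + 1) →
      ∃ i, i < y i ∧ (1 ≤ i ∧ i ≤ n ∧ codeO y i = m) := by
    intro m h1 h2
    obtain ⟨i, hi, hc⟩ := hop m h1 h2
    exact ⟨i, hi, (hopn i hi).1, (hopn i hi).2, (codeO_opener n y hy hinv hvex i hi).1.trans hc⟩
  constructor
  · ext m
    simp only [Set.mem_sdiff, Set.mem_ofPred_eq, Set.mem_singleton_iff, Set.mem_Icc]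
    constructor
    · rintro ⟨⟨i, h1, h2, h3⟩, h4⟩
      have h5 := codeO_le y i
      have h6 : NN y i i ≤ Nat.count P (n + 1) := NN_le_count n y hy i i le_rfl
      omega
    · rintro ⟨h1, h2⟩
      obtain ⟨i, _, h⟩ := hex m h1 h2
      exact ⟨⟨i, h⟩, by omega⟩
  · intro m h1 h2 hno
    obtain ⟨i, hi, h⟩ := hex m h1 h2
    refine ⟨i, h, ?_⟩
    rintro i' ⟨ha, hb, hc⟩
    rcases Nat.lt_or_ge i' (y i') with hlt | hge
    · have e1 : codeO y i' = Nat.count P (i' + 1) := (codeO_opener n y hy hinv hvex i' hlt).1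
      have e2 : codeO y i = Nat.count P (i + 1) := (codeO_opener n y hy hinv hvex i hi).1
      have pi : P i := hi
      have pi' : P i' := hlt
      rw [Nat.count_succ, if_pos pi'] at e1
      rw [Nat.count_succ, if_pos pi] at e2
      exact Nat.count_injective pi' pi (by omega)
    · exfalso
      obtain ⟨x, hx, hxe⟩ := codeO_closer n y hy hinv i' hge (by omega)
      obtain ⟨p, hp1, hp2, hp3⟩ := hEss x hx
      exact hno ⟨p, hp1, hp2, by omega⟩
end UGS
end

section
/- Let y ∈ S_n be a vexillary involution, write Ess(D^O(y)) = {(i_1,j_1) ⊏ ⋯ ⊏ (i_s,j_s)}, and set k_p = j_p − rank y_{[i_p][j_p]} for p ∈ [s] and k_0 = 0. Then the shape sh^O(y) has exactly k_s nonzero parts (i.e. sh^O(y)_k > 0 iff 1 ≤ k ≤ k_s), and for every k with k_{p−1} < k ≤ k_p for some p ∈ [s], sh^O(y)_k = i_p − j_p + 1 + k_p − k. -/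
open Classical

namespace UGS

theorem rank_count (A : Finset ℕ) (m : ℕ) (hm : m ≤ A.card) :
    (A.filter fun a => (A.filter fun b => b ≤ a).card ≤ m).card = m := by
  induction A using Finset.induction_on_max generalizing m with
  | empty => simp at hm; simp [hm]
  | insert a A ha ih =>
    have hna : a ∉ A := fun h => lt_irrefl _ (ha a h)
    rw [Finset.card_insert_of_notMem hna] at hm
    have h1 : ((insert a A).filter fun b => b ≤ a) = insert a A := by
      apply Finset.filter_true_of_mem
      intro x hx
      rcases Finset.mem_insert.1 hx with h | h
      · omega
      · exact (ha x h).le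
    have h2 : ∀ x ∈ A, ((insert a A).filter fun b => b ≤ x) = A.filter fun b => b ≤ x := by
      intro x hx
      rw [Finset.filter_insert, if_neg (by have := ha x hx; omega)]
    have h3 : (A.filter fun x => ((insert a A).filter fun b => b ≤ x).card ≤ m)
        = A.filter fun x => (A.filter fun b => b ≤ x).card ≤ m := by
      apply Finset.filter_congr
      intro x hx
      rw [h2 x hx]
    rw [Finset.filter_insert, h1, h3, Finset.card_insert_of_notMem hna]
    split_ifs with h
    · rw [Finset.card_insert_of_notMem (by simp [hna])]
      have h4 : (A.filter fun x => (A.filter fun b => b ≤ x).card ≤ m) = A := by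
        apply Finset.filter_true_of_mem
        intro x _
        have := Finset.card_filter_le A (fun b => b ≤ x)
        omega
      rw [h4]; omega
    · exact ih m (by omega)

theorem y_bounds {n : ℕ} {y : Equiv.Perm ℕ} (hy : IsPermOn n y)
    (hinv : Function.Involutive ⇑y) {b : ℕ} (h : y b ≠ b) :
    1 ≤ b ∧ b ≤ n ∧ 1 ≤ y b ∧ y b ≤ n := by
  have h1 : b ∈ Finset.Icc 1 n := by
    by_contra hc
    exact h (hy b hc)
  have h2 : y b ∈ Finset.Icc 1 n := by
    by_contra hc
    have := hy _ hc
    rw [hinv b] at this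
    exact h this.symm
  simp only [Finset.mem_Icc] at h1 h2
  omega

theorem exc_lt {n : ℕ} {y : Equiv.Perm ℕ} (hy : IsPermOn n y)
    (hinv : Function.Involutive ⇑y) (hvex : Vexillary n y) {a b : ℕ}
    (ha : a < y a) (hb : b < y b) : a < y b := by
  by_contra hc
  have hne : y b ≠ a := by
    intro h
    have h2 : y a = b := by rw [← h]; exact hinv b
    omega
  have h1 := y_bounds hy hinv (b := a) (by omega)
  have h2 := y_bounds hy hinv (b := b) (by omega)
  refine hvex ⟨b, y b, a, y a, h2.1, hb, by omega, ha, h1.2.2.2, ?_⟩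
  rw [hinv a, hinv b]
  omega

theorem mem_DO {n : ℕ} {y : Equiv.Perm ℕ} (hy : IsPermOn n y)
    (hinv : Function.Involutive ⇑y) (i j : ℕ) :
    (i, j) ∈ DO n y ↔ 1 ≤ j ∧ j ≤ i ∧ j < y i ∧ i < y j := by
  have hs : y.symm j = y j := by
    rw [Equiv.symm_apply_eq]; exact (hinv j).symm
  simp only [DO, Rothe, Set.mem_inter_iff, Set.mem_ofPred_eq, Finset.mem_Icc, hs]
  constructor
  · rintro ⟨⟨h1, h2, h3, h4⟩, h5⟩
    exact ⟨h2.1, h5, h3, h4⟩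
  · rintro ⟨h1, h2, h3, h4⟩
    have := y_bounds hy hinv (b := j) (by omega)
    exact ⟨⟨by omega, by omega, h3, h4⟩, h2⟩

/-- `#{b ≤ j : y b > i}` -/
def kk (y : Equiv.Perm ℕ) (i j : ℕ) : ℕ := ((Finset.Icc 1 j).filter fun b => i < y b).card

theorem pos_y {n : ℕ} {y : Equiv.Perm ℕ} (hy : IsPermOn n y)
    (hinv : Function.Involutive ⇑y) {b : ℕ} (hb : 1 ≤ b) : 1 ≤ y b := by
  by_cases h : y b = b
  · omega
  · exact (y_bounds hy hinv h).2.2.1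

theorem rank_add {n : ℕ} {y : Equiv.Perm ℕ} (hy : IsPermOn n y)
    (hinv : Function.Involutive ⇑y) (i j : ℕ) : rankUL y i j + kk y j i = i := by
  have h := Finset.card_filter_add_card_filter_not (s := Finset.Icc 1 i)
    (fun a => y a ∈ Finset.Icc 1 j)
  have h2 : ((Finset.Icc 1 i).filter fun a => ¬ y a ∈ Finset.Icc 1 j)
      = (Finset.Icc 1 i).filter fun b => j < y b := by
    apply Finset.filter_congr
    intro x hx
    have := pos_y hy hinv (Finset.mem_Icc.1 hx).1
    simp only [Finset.mem_Icc]
    omega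
  rw [h2] at h
  simp only [Nat.card_Icc, Nat.add_sub_cancel] at h
  exact h

theorem rank_symm {y : Equiv.Perm ℕ}
    (hinv : Function.Involutive ⇑y) (i j : ℕ) : rankUL y i j = rankUL y j i := by
  unfold rankUL
  apply Finset.card_bij (fun a _ => y a)
  · intro a ha
    simp only [Finset.mem_filter] at ha ⊢
    rw [hinv a]; exact ⟨ha.2, ha.1⟩
  · intro a _ b _ h
    exact y.injective h
  · intro b hb
    simp only [Finset.mem_filter] at hb
    refine ⟨y b, ?_, hinv b⟩
    simp only [Finset.mem_filter]
    rw [hinv b]; exact ⟨hb.2, hb.1⟩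

theorem exists_ess_s7 {n : ℕ} {y : Equiv.Perm ℕ} (hy : IsPermOn n y)
    (hinv : Function.Involutive ⇑y) {x : ℕ} (hx : 0 < codeO y x) :
    ∃ i j, (i, j) ∈ Ess (DO n y) ∧ x ≤ i ∧ j < y x ∧ codeO y x ≤ kk y i j := by
  set R := (Finset.Icc 1 x).filter fun j => j < y x ∧ x < y j with hR
  have hRmem : ∀ b, b ∈ R ↔ (1 ≤ b ∧ b ≤ x) ∧ b < y x ∧ x < y b := by
    intro b; simp [hR]
  have hRne : R.Nonempty := Finset.card_pos.1 hx
  let P : Finset (ℕ × ℕ) := (Finset.Icc 1 n ×ˢ Finset.Icc 1 n).filter fun c =>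
    c ∈ DO n y ∧ x ≤ c.1 ∧ c.2 < y x ∧ ∀ b ∈ R, b ≤ c.2 ∧ c.1 < y b
  have hP : ∀ i j, (i, j) ∈ P ↔
      (i, j) ∈ DO n y ∧ x ≤ i ∧ j < y x ∧ ∀ b ∈ R, b ≤ j ∧ i < y b := by
    intro i j
    simp only [P, Finset.mem_filter, Finset.mem_product]
    constructor
    · exact fun h => h.2
    · intro h
      exact ⟨⟨h.1.1.1, h.1.1.2.1⟩, h⟩
  have hPne : P.Nonempty := by
    refine ⟨(x, R.max' hRne), (hP _ _).2 ?_⟩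
    have h1 := (hRmem _).1 (R.max'_mem hRne)
    refine ⟨(mem_DO hy hinv _ _).2 ⟨h1.1.1, h1.1.2, h1.2⟩, le_rfl, h1.2.1, ?_⟩
    intro b hb
    exact ⟨R.le_max' b hb, ((hRmem b).1 hb).2.2⟩
  obtain ⟨⟨i, j⟩, hc, hmax⟩ := Finset.exists_max_image P (fun c => c.1 + c.2) hPne
  have hc' := (hP i j).1 hc
  obtain ⟨hD, hxi, hjx, hb⟩ := hc'
  refine ⟨i, j, ⟨hD, ?_, ?_⟩, hxi, hjx, ?_⟩
  · intro h
    have h' := (mem_DO hy hinv _ _).1 h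
    have hne : j + 1 ≠ y x := by
      intro he
      have : y (j + 1) = x := by rw [he]; exact hinv x
      simp only at h'
      omega
    have := hmax (i, j + 1) ((hP _ _).2 ⟨h, hxi, by omega, fun b hbR => by
      have := hb b hbR; omega⟩)
    simp only at this
    omega
  · intro h
    have h' := (mem_DO hy hinv _ _).1 h
    have := hmax (i + 1, j) ((hP _ _).2 ⟨h, by omega, hjx, fun b hbR => by
      have h1 := hb b hbR
      have hne : y b ≠ i + 1 := by
        intro he
        have : y (i + 1) = b := by rw [← he]; exact hinv b
        simp only at h'
        omega
      omega⟩)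
    simp only at this
    omega
  · unfold kk
    apply Finset.card_le_card
    intro b hbR
    have h1 := hb b hbR
    have h2 := (hRmem b).1 hbR
    simp only [Finset.mem_filter, Finset.mem_Icc]
    omega

theorem kk_mono {y : Equiv.Perm ℕ} {i j i' j' : ℕ} (hi : i' ≤ i) (hj : j ≤ j') :
    kk y i j ≤ kk y i' j' := by
  apply Finset.card_le_card
  intro b
  simp only [Finset.mem_filter, Finset.mem_Icc]
  omega

theorem kk_le_code {y : Equiv.Perm ℕ} {i j x : ℕ} (hx : x ≤ i) (hj : j < y x) (hjx : j ≤ x) :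
    kk y i j ≤ codeO y x := by
  apply Finset.card_le_card
  intro b
  simp only [Finset.mem_filter, Finset.mem_Icc]
  omega

theorem key {n : ℕ} {y : Equiv.Perm ℕ} (hy : IsPermOn n y)
    (hinv : Function.Involutive ⇑y) (hvex : Vexillary n y) {i j m : ℕ}
    (hE : (i, j) ∈ Ess (DO n y)) (hm1 : 1 ≤ m) (hm : m ≤ kk y i j)
    (hS : ∀ x, m ≤ codeO y x → x ≤ i ∧ j < y x) :
    shapeO n y m + (m - 1) = kk y j i := by
  obtain ⟨hD, -, hE2⟩ := hE
  obtain ⟨h1, h2, h3, h4⟩ := (mem_DO hy hinv _ _).1 hD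
  have hjn := y_bounds hy hinv (b := j) (by omega)
  set A := (Finset.Icc 1 n).filter fun a => a < y a with hA
  have hAm : ∀ a, a ∈ A ↔ a < y a := by
    intro a
    simp only [hA, Finset.mem_filter, Finset.mem_Icc]
    constructor
    · exact fun h => h.2
    · intro h
      have := y_bounds hy hinv (b := a) (by omega)
      exact ⟨by omega, h⟩
  have hcode : ∀ a ∈ A, codeO y a = (A.filter fun b => b ≤ a).card := by
    intro a ha
    have ha' := (hAm a).1 ha
    unfold codeO
    congr 1
    ext b
    simp only [Finset.mem_filter, Finset.mem_Icc, hAm]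
    constructor
    · omega
    · rintro ⟨hb, hba⟩
      have := exc_lt hy hinv hvex ha' hb
      have := y_bounds hy hinv (b := b) (by omega)
      omega
  have hAi : ∀ a ∈ A, a ≤ i := by
    intro a ha
    have ha' := (hAm a).1 ha
    by_cases hc : y j = i + 1
    · have := exc_lt hy hinv hvex ha' (b := j) (by omega)
      omega
    · have hyi : y (i + 1) ≤ j := by
        by_contra hcc
        exact hE2 ((mem_DO hy hinv _ _).2 ⟨h1, by simp only; omega, by simp only; omega,
          by simp only; omega⟩)
      have := exc_lt hy hinv hvex ha' (b := y (i + 1)) (by rw [hinv]; omega)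
      rw [hinv] at this
      omega
  have hkA : kk y i j ≤ A.card := by
    apply Finset.card_le_card
    intro b
    simp only [Finset.mem_filter, Finset.mem_Icc, hAm]
    omega
  have hcount : (A.filter fun a => ¬ m ≤ codeO y a).card = m - 1 := by
    rw [← rank_count A (m - 1) (by omega)]
    congr 1
    apply Finset.filter_congr
    intro a ha
    rw [hcode a ha]
    omega
  rw [← hcount]
  unfold shapeO kk
  rw [← Finset.card_union_of_disjoint]
  · congr 1
    ext x
    simp only [Finset.mem_union, Finset.mem_filter, Finset.mem_Icc]
    constructor
    · rintro (⟨hx, hxm⟩ | ⟨hx, -⟩)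
      · have := hS x hxm
        omega
      · have hx' := (hAm x).1 hx
        have := hAi x hx
        have := exc_lt hy hinv hvex (a := j) (b := x) (by omega) hx'
        have := y_bounds hy hinv (b := x) (by omega)
        omega
    · rintro ⟨hx, hxj⟩
      by_cases hc : m ≤ codeO y x
      · left; omega
      · right
        refine ⟨(hAm x).2 ?_, hc⟩
        by_contra hcc
        have := kk_le_code (y := y) (i := i) (j := j) (x := x) hx.2 hxj (by omega)
        omega
  · rw [Finset.disjoint_left]
    intro x hx hx'
    simp only [Finset.mem_filter] at hx hx'
    exact hx'.2 hx.2

theorem involution_shape_of_vexillary (n : ℕ) (y : Equiv.Perm ℕ)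
    (hy : IsPermOn n y) (hinv : Function.Involutive ⇑y) (hvex : Vexillary n y)
    (s : ℕ) (e : ℕ → ℕ × ℕ)
    (hchain : ∀ p q, 1 ≤ p → p < q → q ≤ s → SwneLt (e p) (e q))
    (hrange : Ess (DO n y) = {x | ∃ p, 1 ≤ p ∧ p ≤ s ∧ e p = x})
    (k : ℕ → ℕ) (hk0 : k 0 = 0)
    (hk : ∀ p, 1 ≤ p → p ≤ s → k p = (e p).2 - rankUL y (e p).1 (e p).2) :
    (∀ m, 1 ≤ m → (0 < shapeO n y m ↔ m ≤ k s)) ∧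
    (∀ p m, 1 ≤ p → p ≤ s → k (p - 1) < m → m ≤ k p →
      shapeO n y m = (e p).1 - (e p).2 + 1 + k p - m) := by
  have hk' : ∀ p, 1 ≤ p → p ≤ s → k p = kk y (e p).1 (e p).2 := by
    intro p h1 h2
    have := rank_add hy hinv (e p).2 (e p).1
    rw [hk p h1 h2, rank_symm hinv]
    omega
  have hess : ∀ p, 1 ≤ p → p ≤ s → ((e p).1, (e p).2) ∈ Ess (DO n y) := by
    intro p h1 h2
    rw [hrange]
    exact ⟨p, h1, h2, rfl⟩
  have hsw : ∀ p q, 1 ≤ p → p ≤ q → q ≤ s → (e q).1 ≤ (e p).1 ∧ (e p).2 ≤ (e q).2 := by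
    intro p q h1 h2 h3
    rcases Nat.eq_or_lt_of_le h2 with h | h
    · subst h; exact ⟨le_rfl, le_rfl⟩
    · exact (hchain p q h1 h h3).1
  have hmono : ∀ p q, 1 ≤ p → p ≤ q → q ≤ s → k p ≤ k q := by
    intro p q h1 h2 h3
    rw [hk' p h1 (by omega), hk' q (by omega) h3]
    have := hsw p q h1 h2 h3
    exact kk_mono this.1 this.2
  have hex : ∀ x, 0 < codeO y x → ∃ q, 1 ≤ q ∧ q ≤ s ∧ x ≤ (e q).1 ∧ (e q).2 < y x ∧
      codeO y x ≤ k q := by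
    intro x hx
    obtain ⟨i, j, hE, h1, h2, h3⟩ := exists_ess_s7 hy hinv hx
    rw [hrange] at hE
    obtain ⟨q, hq1, hq2, hq⟩ := hE
    refine ⟨q, hq1, hq2, ?_⟩
    rw [hk' q hq1 hq2, hq]
    exact ⟨h1, h2, h3⟩
  constructor
  · intro m hm
    constructor
    · intro h
      obtain ⟨x, hx⟩ := Finset.card_pos.1 h
      have hx2 := (Finset.mem_filter.1 hx).2
      obtain ⟨q, hq1, hq2, -, -, hq⟩ := hex x (by omega)
      have := hmono q s hq1 hq2 le_rfl
      omega
    · intro h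
      have hs : 1 ≤ s := by
        by_contra hc
        have : s = 0 := by omega
        rw [this, hk0] at h
        omega
      have hD := (hess s hs le_rfl).1
      have hD' := (mem_DO hy hinv _ _).1 hD
      have := kk_le_code (y := y) (i := (e s).1) (j := (e s).2) (x := (e s).1) le_rfl
        hD'.2.2.1 hD'.2.1
      rw [hk' s hs le_rfl] at h
      exact Finset.card_pos.2 ⟨(e s).1, Finset.mem_filter.2 ⟨hD.1.1, by omega⟩⟩
  · intro p m hp1 hp2 hm1 hm2
    have hE := hess p hp1 hp2
    have hD' := (mem_DO hy hinv _ _).1 hE.1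
    have hK := key hy hinv hvex hE (m := m) (by omega) (by rw [← hk' p hp1 hp2]; exact hm2) (by
      intro x hx
      obtain ⟨q, hq1, hq2, hq3, hq4, hq⟩ := hex x (by omega)
      have hpq : p ≤ q := by
        by_contra hc
        have := hmono q (p - 1) hq1 (by omega) (by omega)
        omega
      have := hsw p q hp1 hpq hq2
      omega)
    have r1 := rank_add hy hinv (e p).1 (e p).2
    have r2 := rank_add hy hinv (e p).2 (e p).1
    have r3 := rank_symm hinv (e p).1 (e p).2
    have r4 := hk' p hp1 hp2
    have r5 := hD'.2.1
    omega
end UGS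
end

section
/- Let y ∈ S_n be an involution and let a < b satisfy y(a) = b and y(i) < a for every i with a < i < b. Let y' = y·(a,b) (the involution agreeing with y except that a and b are fixed points of y'). Then D(y') = D(y) \ {(a,a)}; consequently D^Sp(y') = D^Sp(y), and rank y'_{[i][j]} = rank y_{[i][j]} for every (i,j) ∈ D^Sp(y). -/
open Classical

namespace UGS

theorem dearcL_step_diagram (n : ℕ) (y : Equiv.Perm ℕ)
    (hy : IsPermOn n y) (hinv : Function.Involutive ⇑y)
    (a b : ℕ) (hab : a < b) (hyab : y a = b)
    (hbetween : ∀ i, a < i → i < b → y i < a) :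
    Rothe n (y * Equiv.swap a b) = Rothe n y \ {(a, a)} ∧
    DSp n (y * Equiv.swap a b) = DSp n y ∧
    ∀ p ∈ DSp n y, rankUL (y * Equiv.swap a b) p.1 p.2 = rankUL y p.1 p.2 := by
  have hyba : y b = a := by rw [← hyab, hinv a]
  have hsymm : y.symm = y := by
    ext c
    rw [Equiv.symm_apply_eq, hinv c]
  have ha : 1 ≤ a := by
    by_contra h
    have h0 : a = 0 := by omega
    have := hy a (by simp [h0])
    omega
  have hpa : (y * Equiv.swap a b) a = a := by simp [hyba]
  have hpb : (y * Equiv.swap a b) b = b := by simp [hyab]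
  have hpo : ∀ c, c ≠ a → c ≠ b → (y * Equiv.swap a b) c = y c := by
    intro c h1 h2
    simp [Equiv.swap_apply_of_ne_of_ne h1 h2]
  have hne : ∀ c, c ≠ a → c ≠ b → y c ≠ a ∧ y c ≠ b := by
    intro c h1 h2
    constructor
    · intro h; exact h2 (y.injective (h.trans hyba.symm))
    · intro h; exact h1 (y.injective (h.trans hyab.symm))
  have hsymm' : (y * Equiv.swap a b).symm = y * Equiv.swap a b := by
    ext c
    rw [Equiv.symm_apply_eq]
    by_cases h1 : c = a
    · rw [h1, hpa, hpa]
    by_cases h2 : c = b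
    · rw [h2, hpb, hpb]
    rw [hpo c h1 h2, hpo _ (hne c h1 h2).1 (hne c h1 h2).2, hinv c]
  have hR : Rothe n (y * Equiv.swap a b) = Rothe n y \ {(a, a)} := by
    ext ⟨i, j⟩
    simp only [Rothe, Set.mem_ofPred_eq, Set.mem_sdiff, Set.mem_singleton_iff, Prod.mk.injEq,
      hsymm, hsymm']
    have key : ∀ c, (c = a ∧ (y * Equiv.swap a b) c = a ∧ y c = b) ∨
        (c = b ∧ (y * Equiv.swap a b) c = b ∧ y c = a) ∨
        (c ≠ a ∧ c ≠ b ∧ (y * Equiv.swap a b) c = y c ∧ (a < c → c < b → y c < a)) := by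
      intro c
      by_cases h1 : c = a
      · subst h1; exact Or.inl ⟨rfl, hpa, hyab⟩
      by_cases h2 : c = b
      · subst h2; exact Or.inr (Or.inl ⟨rfl, hpb, hyba⟩)
      exact Or.inr (Or.inr ⟨h1, h2, hpo c h1 h2, hbetween c⟩)
    have ki := key i
    have kj := key j
    simp only [Finset.mem_Icc]
    generalize (y * Equiv.swap a b) i = zi at *
    generalize (y * Equiv.swap a b) j = zj at *
    rcases ki with ki | ki | ki <;> rcases kj with kj | kj | kj <;> omega
  refine ⟨hR, ?_, ?_⟩
  · ext ⟨i, j⟩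
    simp only [DSp, hR, Set.mem_inter_iff, Set.mem_sdiff, Set.mem_singleton_iff, Prod.mk.injEq,
      Set.mem_ofPred_eq]
    constructor
    · rintro ⟨⟨h1, _⟩, h2⟩; exact ⟨h1, h2⟩
    · rintro ⟨h1, h2⟩; exact ⟨⟨h1, by omega⟩, h2⟩
  · rintro ⟨i, j⟩ ⟨⟨h1, h2, h3, h4⟩, h5⟩
    simp only [Set.mem_ofPred_eq] at h1 h2 h3 h4 h5
    unfold rankUL
    by_cases hja : j < a
    · congr 1
      apply Finset.filter_congr
      intro c _
      by_cases c1 : c = a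
      · rw [c1, hpa, hyab]; simp only [Finset.mem_Icc]; omega
      by_cases c2 : c = b
      · rw [c2, hpb, hyba]; simp only [Finset.mem_Icc]; omega
      rw [hpo c c1 c2]
    · have hib : b ≤ i := by
        by_contra h
        have := hbetween i (by omega) (by omega)
        omega
      have hmem : ∀ c, c ∈ Finset.Icc 1 i → Equiv.swap a b c ∈ Finset.Icc 1 i := by
        intro c hc
        simp only [Finset.mem_Icc] at hc ⊢
        rw [Equiv.swap_apply_def]
        split_ifs <;> omega
      apply Finset.card_nbij' (Equiv.swap a b) (Equiv.swap a b)
      · intro c hc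
        simp only [Finset.coe_filter, Set.mem_ofPred_eq] at hc ⊢
        exact ⟨hmem c hc.1, hc.2⟩
      · intro c hc
        simp only [Finset.coe_filter, Set.mem_ofPred_eq] at hc ⊢
        refine ⟨hmem c hc.1, ?_⟩
        rw [Equiv.Perm.mul_apply, Equiv.swap_apply_self]
        exact hc.2
      · intro c _; simp
      · intro c _; simp
end UGS
end

section
/- Let y ∈ S_n be an involution and let a < b satisfy y(a) = b, y(i) > b for every i with a < i < b, and rank y_{[b][b]} even. Let y' = y·(a,b). Then: (a) Ess(D^Sp(y')) and Ess(D^Sp(y)) have the same intersection with the complement of the square [a,b]×[a,b]; (b) rank y_{[i][j]} = rank y'_{[i][j]} for every (i,j) such that (i,j) ∈ Ess(D^Sp(y')) or (i,j) ∉ [a,b)×[a,b) (where [a,b) = {c : a ≤ c < b}). -/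
open Classical

namespace UGS

theorem dearcR_step_diagram (n : ℕ) (y : Equiv.Perm ℕ)
    (hy : IsPermOn n y) (hinv : Function.Involutive ⇑y)
    (a b : ℕ) (hab : a < b) (hyab : y a = b)
    (hbetween : ∀ i, a < i → i < b → b < y i)
    (heven : Even (rankUL y b b)) :
    (∀ p : ℕ × ℕ, p ∉ Set.Icc a b ×ˢ Set.Icc a b →
      (p ∈ Ess (DSp n (y * Equiv.swap a b)) ↔ p ∈ Ess (DSp n y))) ∧
    (∀ p : ℕ × ℕ,
      p ∈ Ess (DSp n (y * Equiv.swap a b)) ∨ p ∉ Set.Ico a b ×ˢ Set.Ico a b →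
      rankUL y p.1 p.2 = rankUL (y * Equiv.swap a b) p.1 p.2) := by
  have hyb : y b = a := by rw [← hyab]; exact hinv a
  have hinj : ∀ c d, y c = d → y d = c := fun c d h => by rw [← h]; exact hinv c
  have ha1 : 1 ≤ a ∧ a ≤ n := by
    by_contra h
    have := hy a (by simpa using h)
    omega
  have hb1 : 1 ≤ b ∧ b ≤ n := by
    by_contra h
    have := hy b (by simpa using h)
    omega
  obtain ⟨z, hz⟩ : ∃ z, z = y * Equiv.swap a b := ⟨_, rfl⟩
  rw [← hz]
  have hza : z a = a := by simp [hz, hyb]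
  have hzb : z b = b := by simp [hz, hyab]
  have hzc : ∀ c, c ≠ a → c ≠ b → z c = y c := fun c h1 h2 => by
    simp [hz, Equiv.swap_apply_of_ne_of_ne h1 h2]
  have hys : ∀ c, y.symm c = y c := fun c => by
    rw [Equiv.symm_apply_eq]; exact (hinv c).symm
  have hzs : ∀ c, z.symm c = z c := fun c => by
    rw [Equiv.symm_apply_eq]
    by_cases h1 : c = a
    · subst h1; rw [hza, hza]
    by_cases h2 : c = b
    · subst h2; rw [hzb, hzb]
    rw [hzc c h1 h2, hzc (y c), hinv c]
    · intro h; have := hinj _ _ h; omega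
    · intro h; have := hinj _ _ h; omega
  have mD : ∀ w : Equiv.Perm ℕ, (∀ c, w.symm c = w c) → ∀ i j, (i, j) ∈ DSp n w ↔
      (1 ≤ j ∧ j < i ∧ i ≤ n ∧ j < w i ∧ i < w j) := by
    intro w hw i j
    simp only [DSp, Rothe, Set.mem_inter_iff, Set.mem_setOf_eq, Finset.mem_Icc, hw]
    constructor
    · rintro ⟨⟨_, _, _, _⟩, _⟩; omega
    · rintro ⟨_, _, _, _, _⟩; omega
  have mDy := mD y hys
  have mDz := mD z hzs
  have key : ∀ i j, ¬ (a ≤ i ∧ i ≤ b ∧ a ≤ j ∧ j ≤ b) →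
      ((i, j) ∈ DSp n z ↔ (i, j) ∈ DSp n y) := by
    intro i j h
    rw [mDy, mDz]
    by_cases h1 : i = a
    · subst h1
      by_cases h3 : j = i
      · omega
      by_cases h4 : j = b
      · omega
      rw [hzc j h3 h4, hza, hyab]; omega
    by_cases h2 : i = b
    · subst h2
      by_cases h3 : j = a
      · omega
      by_cases h4 : j = i
      · omega
      rw [hzc j h3 h4, hzb, hyb]; omega
    rw [hzc i h1 h2]
    by_cases h3 : j = a
    · subst h3; rw [hza, hyab]; omega
    by_cases h4 : j = b
    · subst h4; rw [hzb, hyb]; omega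
    rw [hzc j h3 h4]
  have keyEss : ∀ i j, a ≤ i → i < b → a ≤ j → j < b → (i, j) ∉ Ess (DSp n z) := by
    rintro i j h1 h2 h3 h4 ⟨h5, -, h7⟩
    simp only [mDz] at h5 h7
    have e1 : j ≠ a := by rintro rfl; omega
    have := hzc j e1 (by omega)
    have := hbetween j (by omega) h4
    apply h7
    by_cases e2 : i + 1 = b
    · rw [e2, hzb]; omega
    · have := hbetween (i+1) (by omega) (by omega)
      have := hzc (i+1) (by omega) e2
      omega
  constructor
  · rintro ⟨i, j⟩ hp
    have hp' : ¬ (a ≤ i ∧ i ≤ b ∧ a ≤ j ∧ j ≤ b) := by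
      intro h; apply hp
      simp only [Set.mem_prod, Set.mem_Icc]; omega
    by_cases hA : a < i ∧ i < b ∧ j + 1 = a
    · obtain ⟨hA1, hA2, rfl⟩ := hA
      have hyi := hbetween i hA1 hA2
      constructor
      · rintro ⟨h5, -, h7⟩
        exfalso
        simp only [mDz] at h5 h7
        apply h7
        have ej := hzc j (by omega) (by omega)
        by_cases e2 : i + 1 = b
        · have : y j ≠ b := by intro h; have := hinj _ _ h; omega
          rw [e2, hzb]; omega
        · have h8 := hbetween (i+1) (by omega) (by omega)
          have := hzc (i+1) (by omega) e2
          have : y j ≠ i + 1 := by intro h; have := hinj _ _ h; omega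
          omega
      · rintro ⟨h5, h6, -⟩
        exfalso
        simp only [mDy] at h5 h6
        apply h6
        omega
    · have k1 : (i, j+1) ∈ DSp n z ↔ (i, j+1) ∈ DSp n y := by
        by_cases h : (a ≤ i ∧ i ≤ b ∧ a ≤ j+1 ∧ j+1 ≤ b)
        · have e : j + 1 = a := by omega
          rw [mDy, mDz, e, hza, hyab]
          by_cases h1 : i = a
          · omega
          have h2 : i = b := by omega
          omega
        · exact key _ _ h
      have k2 : (i+1, j) ∈ DSp n z ↔ (i+1, j) ∈ DSp n y := by
        by_cases h : (a ≤ i+1 ∧ i+1 ≤ b ∧ a ≤ j ∧ j ≤ b)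
        · rw [mDy, mDz]; omega
        · exact key _ _ h
      have k0 := key i j hp'
      simp only [Ess, Set.mem_setOf_eq, k0, k1, k2]
  · rintro ⟨i, j⟩ hp
    have hp' : ¬ (a ≤ i ∧ i < b ∧ a ≤ j ∧ j < b) := by
      rintro ⟨h1, h2, h3, h4⟩
      rcases hp with hp | hp
      · exact keyEss i j h1 h2 h3 h4 hp
      · apply hp
        simp only [Set.mem_prod, Set.mem_Ico]; omega
    simp only [rankUL]
    by_cases hib : b ≤ i
    · have sw : ∀ c, 1 ≤ c ∧ c ≤ i ↔ 1 ≤ Equiv.swap a b c ∧ Equiv.swap a b c ≤ i := by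
        intro c
        rw [Equiv.swap_apply_def]
        split_ifs <;> omega
      refine Finset.card_equiv (Equiv.swap a b) ?_
      intro c
      simp only [Finset.mem_filter, Finset.mem_Icc, ← sw, hz, Equiv.Perm.mul_apply,
        Equiv.swap_apply_self]
    · congr 1
      apply Finset.filter_congr
      intro c hc
      simp only [Finset.mem_Icc] at hc ⊢
      by_cases h1 : c = a
      · subst h1; rw [hza, hyab]; omega
      · rw [hzc c h1 (by omega)]
end UGS
end

section
/- For every fixed-point-free involution z ∈ S_{2r}, the involution shapes satisfy sh^Sp(z) = sh^Sp(dearc^R(z)) = sh^Sp(dearc^L(z)). -/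
open Classical

namespace UGS

/-- `c^Sp_i(y) = #{j ∈ [i-1] : y(i) > j, y(j) > i}`. -/
def codeSpF (y : ℕ → ℕ) (i : ℕ) : ℕ :=
  ((Finset.Ico 1 i).filter fun j => j < y i ∧ i < y j).card

/-- `sh^Sp(y)_k = #{i ∈ [n] : c^Sp_i(y) ≥ k}`. -/
def shapeSpF (n : ℕ) (y : ℕ → ℕ) (k : ℕ) : ℕ :=
  ((Finset.Icc 1 n).filter fun i => k ≤ codeSpF y i).card

/-- `dearc^R(z)`: keep a 2-cycle `(a,b)`, `a < b`, of the fixed-point-free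
involution `z` iff some other 2-cycle has its right endpoint strictly
between `a` and `b`; drop it (making `a`, `b` fixed points) otherwise. -/
noncomputable def dearcRFun (z : ℕ → ℕ) (x : ℕ) : ℕ :=
  if ∃ c, min x (z x) < c ∧ c < max x (z x) ∧ z c < c then z x else x

/-- `dearc^L(z)`: keep a 2-cycle `(a,b)`, `a < b`, of the fixed-point-free
involution `z` iff some other 2-cycle has its left endpoint strictly
between `a` and `b`; drop it otherwise. -/
noncomputable def dearcLFun (z : ℕ → ℕ) (x : ℕ) : ℕ :=
  if ∃ c, min x (z x) < c ∧ c < max x (z x) ∧ c < z c then z x else x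

def DropR (z : ℕ → ℕ) (a : ℕ) : Prop := a < z a ∧ ∀ c, a < c → c < z a → ¬ z c < c
def DropL (z : ℕ → ℕ) (a : ℕ) : Prop := a < z a ∧ ∀ c, a < c → c < z a → ¬ c < z c

theorem dearcR_eq (z : ℕ → ℕ) (hinv : ∀ x, z (z x) = x) (x : ℕ) :
    dearcRFun z x = if DropR z x ∨ DropR z (z x) then x else z x := by
  unfold dearcRFun DropR
  rw [hinv]
  rcases lt_trichotomy x (z x) with h | h | h
  · rw [min_eq_left h.le, max_eq_right h.le]
    split_ifs with h1 h2 h2 <;> grind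
  · rw [← h]; simp
  · rw [min_eq_right h.le, max_eq_left h.le]
    split_ifs with h1 h2 h2 <;> grind

theorem dearcL_eq (z : ℕ → ℕ) (hinv : ∀ x, z (z x) = x) (x : ℕ) :
    dearcLFun z x = if DropL z x ∨ DropL z (z x) then x else z x := by
  unfold dearcLFun DropL
  rw [hinv]
  rcases lt_trichotomy x (z x) with h | h | h
  · rw [min_eq_left h.le, max_eq_right h.le]
    split_ifs with h1 h2 h2 <;> grind
  · rw [← h]; simp
  · rw [min_eq_right h.le, max_eq_left h.le]
    split_ifs with h1 h2 h2 <;> grind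

theorem codeL (n : ℕ) (z : ℕ → ℕ) (hinv : ∀ x, z (z x) = x)
    (hfpf : ∀ i, 1 ≤ i → i ≤ n → z i ≠ i) (i : ℕ) (h1 : 1 ≤ i) (h2 : i ≤ n) :
    codeSpF z i = codeSpF (dearcLFun z) i := by
  unfold codeSpF
  congr 1
  apply Finset.filter_congr
  intro j hj
  rw [Finset.mem_Ico] at hj
  have hi := hfpf i h1 h2
  have hi' := hinv i
  have hj' := hinv j
  rw [dearcL_eq z hinv, dearcL_eq z hinv]
  by_cases hdj : DropL z j
  · have a1 := hdj.2 i hj.2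
    have a2 := hdj.2 (z i)
    rw [if_pos (Or.inl hdj : DropL z j ∨ DropL z (z j))]
    constructor
    · intro h; omega
    · intro h; omega
  · by_cases hdj' : DropL z (z j)
    · have := hdj'.1
      rw [if_pos (Or.inr hdj' : DropL z j ∨ DropL z (z j))]
      omega
    · rw [if_neg (by tauto : ¬ (DropL z j ∨ DropL z (z j)))]
      split_ifs with h
      · rcases h with h | h
        · have := h.1
          omega
        · have b1 := h.1
          have b2 := h.2 j
          rw [hi'] at b1 b2
          have b3 : j = z i → z j = i := by rintro rfl; exact hi'
          omega
      · rfl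

theorem dropR_unique (z : ℕ → ℕ) (hinv : ∀ x, z (z x) = x) {a b x : ℕ}
    (ha : DropR z a) (hb : DropR z b) (h1 : a ≤ x) (h2 : x ≤ z a) (h3 : b ≤ x) (h4 : x ≤ z b) :
    a = b := by
  have a1 := ha.2 (z b)
  have b1 := hb.2 (z a)
  have a0 := ha.1
  have b0 := hb.1
  rw [hinv] at a1 b1
  have e1 := hinv a
  have e2 := hinv b
  have c1 : a = z b → z a = b := by rintro rfl; exact e2
  have c2 : b = z a → z b = a := by rintro rfl; exact e1
  have c3 : z a = z b → a = b := by intro h; rw [← e1, h, e2]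
  omega

noncomputable def sig (z : ℕ → ℕ) (i : ℕ) : ℕ :=
  if DropR z i then z i else if ∃ a, DropR z a ∧ a < i ∧ i ≤ z a then i - 1 else i

theorem sig_cases (z : ℕ → ℕ) (i : ℕ) :
    (DropR z i ∧ sig z i = z i) ∨ (∃ a, DropR z a ∧ a < i ∧ i ≤ z a ∧ sig z i = i - 1) ∨
    ((∀ a, DropR z a → a ≤ i → i ≤ z a → False) ∧ sig z i = i) := by
  unfold sig
  split_ifs with h1 h2
  · left; exact ⟨h1, rfl⟩
  · right; left
    obtain ⟨a, h, h', h''⟩ := h2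
    exact ⟨a, h, h', h'', rfl⟩
  · right; right
    refine ⟨fun a h h' h'' => ?_, rfl⟩
    rcases h'.eq_or_lt with rfl | h3
    · exact h1 h
    · exact h2 ⟨a, h, h3, h''⟩

theorem sig_inj (z : ℕ → ℕ) (hinv : ∀ x, z (z x) = x) : Function.Injective (sig z) := by
  intro i j hij
  have key := fun a b x ha hb h1 h2 h3 h4 =>
    dropR_unique z hinv (a := a) (b := b) (x := x) ha hb h1 h2 h3 h4
  rcases sig_cases z i with ⟨hi, ei⟩ | ⟨a, ha, ha1, ha2, ei⟩ | ⟨hi, ei⟩ <;>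
  rcases sig_cases z j with ⟨hj, ej⟩ | ⟨b, hb, hb1, hb2, ej⟩ | ⟨hj, ej⟩ <;>
  rw [ei, ej] at hij
  · rw [← hinv i, hij, hinv]
  · have := hi.1
    have := key i b (z i) hi hb (by omega) (by omega) (by omega) (by omega)
    subst this; omega
  · exact (hj i hi (by have := hi.1; omega) (by omega)).elim
  · have := hj.1
    have := key j a (z j) hj ha (by omega) (by omega) (by omega) (by omega)
    subst this; omega
  · omega
  · exact (hj a ha (by omega) (by omega)).elim
  · exact (hi j hj (by have := hj.1; omega) (by omega)).elim
  · exact (hi b hb (by omega) (by omega)).elim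
  · exact hij

theorem codeR (n : ℕ) (z : ℕ → ℕ) (hinv : ∀ x, z (z x) = x)
    (hout : ∀ i, ¬ (1 ≤ i ∧ i ≤ n) → z i = i)
    (hfpf : ∀ i, 1 ≤ i → i ≤ n → z i ≠ i) (i : ℕ) (h1 : 1 ≤ i) (h2 : i ≤ n) :
    codeSpF (dearcRFun z) i = codeSpF z (sig z i) := by
  have zi : ∀ {x y}, z x = y → z y = x := by rintro x y rfl; exact hinv x
  have key := fun a b x ha hb h1 h2 h3 h4 =>
    dropR_unique z hinv (a := a) (b := b) (x := x) ha hb h1 h2 h3 h4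
  have ylt : ∀ j i, j < i → (i < dearcRFun z j ↔ i < z j ∧ ¬ DropR z j) := by
    intro j i hj
    rw [dearcR_eq z hinv]
    split_ifs with h
    · rcases h with h | h
      · simp [h]; omega
      · have := h.1
        rw [hinv] at this
        omega
    · tauto
  unfold codeSpF
  rcases sig_cases z i with ⟨hi, ei⟩ | ⟨a, ha, ha1, ha2, ei⟩ | ⟨hi, ei⟩ <;> rw [ei]
  · have hy : dearcRFun z i = i := by rw [dearcR_eq z hinv, if_pos (Or.inl hi)]
    have i0 := hi.1
    rw [hinv, hy]
    congr 1
    ext j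
    simp only [Finset.mem_filter, Finset.mem_Ico]
    constructor
    · rintro ⟨⟨h3, h4⟩, h5, h6⟩
      rw [ylt j i h4] at h6
      have q := hi.2 (z j) h6.1
      rw [hinv] at q
      have : z j = z i → j = i := by intro h; rw [← hinv j, h, hinv]
      omega
    · rintro ⟨⟨h3, h4⟩, h5, h6⟩
      refine ⟨⟨h3, h5⟩, h5, (ylt j i h5).2 ⟨by omega, fun hd => ?_⟩⟩
      have := key i j i hi hd (by omega) (by omega) (by omega) (by omega)
      omega
  · have a0 := ha.1
    have hapos : 1 ≤ a := by
      by_contra h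
      have := hout a (by omega)
      omega
    have hy : i ≤ dearcRFun z i := by
      rw [dearcR_eq z hinv]
      split_ifs with h
      · exact le_rfl
      · rcases ha2.eq_or_lt with h3 | h3
        · exact (h (Or.inr (by rw [h3, hinv]; exact ha))).elim
        · have := ha.2 i ha1 h3
          omega
    have hop : i - 1 < z (i - 1) := by
      rcases (show a ≤ i - 1 by omega).eq_or_lt with h3 | h3
      · rw [← h3]; exact a0
      · have := ha.2 (i - 1) h3 (by omega)
        have := hfpf (i - 1) (by omega) (by omega)
        omega
    have hS : insert a ((Finset.Ico 1 i).filter fun j => j < dearcRFun z i ∧ i < dearcRFun z j)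
        = insert (i - 1) ((Finset.Ico 1 (i - 1)).filter fun j => j < z (i - 1) ∧ i - 1 < z j) := by
      ext j
      simp only [Finset.mem_insert, Finset.mem_filter, Finset.mem_Ico]
      constructor
      · rintro (rfl | ⟨⟨h3, h4⟩, h5, h6⟩)
        · omega
        · rw [ylt j i h4] at h6
          omega
      · intro h
        have h3 : 1 ≤ j ∧ j < i ∧ i - 1 < z j := by
          rcases h with rfl | h
          · omega
          · omega
        by_cases hja : j = a
        · left; exact hja
        · right
          refine ⟨⟨by omega, by omega⟩, by omega, (ylt j i h3.2.1).2 ⟨?_, fun hd => hja ?_⟩⟩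
          · have : z j ≠ i := by
              intro h4
              have h5 := zi h4
              have : i = z a → j = a := by intro h; rw [← h5, h, hinv]
              have := ha.2 i ha1
              omega
            omega
          · exact key j a i hd ha (by omega) (by omega) (by omega) (by omega)
    have hc := congrArg Finset.card hS
    rw [Finset.card_insert_of_notMem, Finset.card_insert_of_notMem] at hc
    · omega
    · simp
    · simp only [Finset.mem_filter, Finset.mem_Ico]
      rintro ⟨_, _, h⟩
      rw [ylt a i ha1] at h
      exact h.2 ha
  · have hy : dearcRFun z i = z i := by
      rw [dearcR_eq z hinv, if_neg]
      rintro (h | h)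
      · exact hi i h le_rfl h.1.le
      · have := h.1
        rw [hinv] at this
        exact hi _ h this.le (by rw [hinv])
    rw [hy]
    congr 1
    apply Finset.filter_congr
    intro j hj
    rw [Finset.mem_Ico] at hj
    rw [ylt j i hj.2]
    constructor
    · tauto
    · rintro ⟨h3, h4⟩
      exact ⟨h3, h4, fun hd => hi j hd hj.2.le h4.le⟩

theorem shapeSp_dearc (r : ℕ) (z : Equiv.Perm ℕ)
    (hz : IsPermOn (2 * r) z) (hinv : Function.Involutive ⇑z)
    (hfpf : ∀ i, 1 ≤ i → i ≤ 2 * r → z i ≠ i) :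
    (∀ k, shapeSpF (2 * r) ⇑z k = shapeSpF (2 * r) (dearcRFun ⇑z) k) ∧
    (∀ k, shapeSpF (2 * r) ⇑z k = shapeSpF (2 * r) (dearcLFun ⇑z) k) := by
  have hout : ∀ i, ¬ (1 ≤ i ∧ i ≤ 2 * r) → z i = i := by
    intro i hi
    apply hz
    rwa [Finset.mem_Icc]
  refine ⟨fun k => ?_, fun k => ?_⟩
  · unfold shapeSpF
    have himg : (Finset.Icc 1 (2 * r)).image (sig z) = Finset.Icc 1 (2 * r) := by
      apply Finset.eq_of_subset_of_card_le
      · intro x hx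
        rw [Finset.mem_image] at hx
        obtain ⟨i, hi, rfl⟩ := hx
        rw [Finset.mem_Icc] at hi ⊢
        rcases sig_cases z i with ⟨h, ei⟩ | ⟨a, ha, ha1, ha2, ei⟩ | ⟨h, ei⟩ <;> rw [ei]
        · by_contra hc
          have h3 := hout _ hc
          rw [hinv] at h3
          have := h.1
          omega
        · have a0 := ha.1
          have : 1 ≤ a := by
            by_contra h
            have := hout a (by omega)
            omega
          omega
        · exact hi
      · rw [Finset.card_image_of_injective _ (sig_inj z hinv)]
    conv_lhs => rw [← himg]
    rw [Finset.filter_image, Finset.card_image_of_injective _ (sig_inj z hinv)]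
    congr 1
    apply Finset.filter_congr
    intro i hi
    rw [Finset.mem_Icc] at hi
    rw [codeR (2 * r) z hinv hout hfpf i hi.1 hi.2]
  · unfold shapeSpF
    congr 1
    apply Finset.filter_congr
    intro i hi
    rw [Finset.mem_Icc] at hi
    rw [codeL (2 * r) z hinv hfpf i hi.1 hi.2]
end UGS
end

section
/- Let z ∈ S_n be a fixed-point-free involution. Then for every (i,j) ∈ Ess(D^Sp(dearc^R(z))), one has rank dearc^R(z)_{[i][j]} = rank z_{[i][j]}. -/
open Classical

namespace UGS

/-- For an involution `y`, the diagram
`D^Sp(y) = {(i,j) ∈ [n]×[n] : j < y(i), i < y⁻¹(j) = y(j), i > j}`. -/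
def DSpF (n : ℕ) (y : ℕ → ℕ) : Set (ℕ × ℕ) :=
  {p | p.1 ∈ Finset.Icc 1 n ∧ p.2 ∈ Finset.Icc 1 n ∧
       p.2 < y p.1 ∧ p.1 < y p.2 ∧ p.2 < p.1}

/-- `rank y_{[i][j]} = #{a ∈ [i] : y(a) ∈ [j]}`. -/
def rankULF (y : ℕ → ℕ) (i j : ℕ) : ℕ :=
  ((Finset.Icc 1 i).filter fun a => y a ∈ Finset.Icc 1 j).card

theorem dearc_cases (z : ℕ → ℕ) (hinv : Function.Involutive z) (x : ℕ) :
    (dearcRFun z x = z x ∧ dearcRFun z (z x) = x) ∨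
    (dearcRFun z x = x ∧ dearcRFun z (z x) = z x ∧
      ∀ c, min x (z x) < c → c < max x (z x) → c ≤ z c) := by
  unfold dearcRFun
  rw [hinv x, min_comm (z x) x, max_comm (z x) x]
  by_cases h : ∃ c, min x (z x) < c ∧ c < max x (z x) ∧ z c < c
  · left; simp only [if_pos h, and_self]
  · right
    simp only [if_neg h, true_and]
    intro c h1 h2
    by_contra h3
    exact h ⟨c, h1, h2, not_le.mp h3⟩

theorem rank_eq_on_essential_of_dearcR (n : ℕ) (z : Equiv.Perm ℕ)
    (hz : IsPermOn n z) (hinv : Function.Involutive ⇑z)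
    (hfpf : ∀ i, 1 ≤ i → i ≤ n → z i ≠ i) :
    ∀ p ∈ Ess (DSpF n (dearcRFun ⇑z)),
      rankULF (dearcRFun ⇑z) p.1 p.2 = rankULF ⇑z p.1 p.2 := by
  rintro ⟨i, j⟩ ⟨⟨hi, hj, hji, hij, hlt⟩, -, h2⟩
  simp only [Finset.mem_Icc] at hi hj hji hij hlt
  have hD := dearc_cases z hinv
  have hrange : ∀ x, 1 ≤ x → x ≤ n → 1 ≤ z x ∧ z x ≤ n := by
    intro x hx1 hx2
    by_contra hc
    have h3 : z (z x) = z x := hz _ (by simpa only [Finset.mem_Icc] using hc)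
    rw [hinv x] at h3
    exact hfpf x hx1 hx2 h3.symm
  have key : ∀ a, 1 ≤ a → a ≤ j → dearcRFun z a = a → z a ≤ i := by
    intro a ha1 haj hay
    by_contra hb
    push Not at hb
    have hne : a ≠ j := by rintro rfl; omega
    have hra := hrange a ha1 (by omega)
    have hfa := hfpf a ha1 (by omega)
    have haa := hinv a
    have hmid : dearcRFun z (z a) = z a ∧ ∀ c, a < c → c < z a → c ≤ z c := by
      rcases hD a with ⟨h, -⟩ | ⟨-, h, h'⟩
      · omega
      · refine ⟨h, fun c h1 h2 => h' c ?_ ?_⟩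
        · exact lt_of_le_of_lt (min_le_left _ _) h1
        · exact lt_of_lt_of_le h2 (le_max_right _ _)
    obtain ⟨hyb, hmid⟩ := hmid
    have hyj : dearcRFun z j = z j := by
      rcases hD j with ⟨h, -⟩ | ⟨h, -⟩ <;> omega
    have hzj : z a < z j := by
      have h3 : z j ≠ z a := fun h => hne (z.injective h).symm
      by_contra h4
      have h5 := hmid (z j) (by omega) (by omega)
      rw [hinv j] at h5
      omega
    apply h2
    refine ⟨?_, ?_, ?_, ?_, ?_⟩ <;> simp only [Finset.mem_Icc]
    · omega
    · omega
    · rcases Nat.lt_or_ge (i + 1) (z a) with h | h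
      · have := hmid (i + 1) (by omega) h
        rcases hD (i + 1) with ⟨h, -⟩ | ⟨h, -⟩ <;> omega
      · have : i + 1 = z a := by omega
        rw [this, hyb]; omega
    · omega
    · omega
  unfold rankULF
  refine Finset.card_nbij' (fun x => z (dearcRFun z x)) (fun x => dearcRFun z (z x)) ?_ ?_ ?_ ?_
  · intro x hx
    simp only [Finset.coe_filter, Finset.mem_Icc, Set.mem_setOf_eq] at hx ⊢
    rw [hinv]
    refine ⟨?_, hx.2⟩
    rcases hD x with ⟨h, -⟩ | ⟨h, -⟩
    · rw [h, hinv x]; exact hx.1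
    · rw [h]
      exact ⟨(hrange x (by omega) (by omega)).1, key x (by omega) (by omega) h⟩
  · intro x hx
    simp only [Finset.coe_filter, Finset.mem_Icc, Set.mem_setOf_eq] at hx ⊢
    rcases hD x with ⟨h, h'⟩ | ⟨h, h', -⟩
    · rw [h', h]; omega
    · rw [h', h']; omega
  · intro x hx
    simp only [hinv _]
    rcases hD x with ⟨h, h'⟩ | ⟨h, h', -⟩
    · rw [h, h']
    · rw [h, h]
  · intro x hx
    rcases hD x with ⟨h, h'⟩ | ⟨h, h', -⟩
    · simp only [h', h, hinv x]
    · simp only [h', h, hinv x]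
end UGS
end

section
/- Let f, f' : ℂⁿ → (ℂⁿ)* be invertible linear maps and let E_•, F_•, E'_•, F'_• be complete flags in ℂⁿ. Then: (1) there exists a unique permutation w ∈ S_n such that rank(F_j →f E_i*) = rank w_{[i][j]} for all i, j ∈ [n]; (2) rank(F_j →f E_i*) = rank(F'_j →f' E'_i*) for all i, j ∈ [n] if and only if there exist invertible linear maps g₁, g₂ : ℂⁿ → ℂⁿ with f' = (g₁*)⁻¹ ∘ f ∘ g₂⁻¹, E'_i = g₁(E_i) and F'_i = g₂(F_i) for all i ∈ [n], where g* : (ℂⁿ)* → (ℂⁿ)* denotes the dual (transpose) map of g. -/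
open Classical

namespace UGS

/-- A complete flag `0 = E_0 ⊆ E_1 ⊆ ⋯ ⊆ E_n = ℂⁿ` with `dim E_i = i`. -/
def IsCompleteFlag (n : ℕ) (E : ℕ → Submodule ℂ (Fin n → ℂ)) : Prop :=
  (∀ i j, i ≤ j → E i ≤ E j) ∧ (∀ i, i ≤ n → Module.finrank ℂ ↥(E i) = i) ∧
  E n = ⊤

/-- `rank(F →f E*)`: the rank of the composition
`F ↪ ℂⁿ →f (ℂⁿ)* ↠ E*`, where the last map restricts a functional to `E`. -/
noncomputable def rkFE {n : ℕ}
    (f : (Fin n → ℂ) →ₗ[ℂ] Module.Dual ℂ (Fin n → ℂ))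
    (F E : Submodule ℂ (Fin n → ℂ)) : ℕ :=
  Module.finrank ℂ ↥(LinearMap.range (E.subtype.dualMap ∘ₗ (f ∘ₗ F.subtype)))

/-- Rank step for permutations. -/
theorem rankUL_succ (w : Equiv.Perm ℕ) (i j : ℕ) :
    rankUL w (i+1) j = rankUL w i j + if w (i+1) ∈ Finset.Icc 1 j then 1 else 0 := by
  unfold rankUL
  have : Finset.Icc 1 (i+1) = insert (i+1) (Finset.Icc 1 i) := by
    ext a; simp only [Finset.mem_Icc, Finset.mem_insert]; omega
  rw [this, Finset.filter_insert]
  split_ifs with h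
  · rw [Finset.card_insert_of_notMem]
    simp
  · simp

theorem perm_mem {n : ℕ} {w : Equiv.Perm ℕ} (hw : IsPermOn n w) {i : ℕ}
    (hi : i ∈ Finset.Icc 1 n) : w i ∈ Finset.Icc 1 n := by
  by_contra h
  have := hw _ h
  have := w.injective this
  rw [this] at h
  exact h hi

theorem perm_unique {n : ℕ} {w w' : Equiv.Perm ℕ} (hw : IsPermOn n w) (hw' : IsPermOn n w')
    (h : ∀ i j, 1 ≤ i → i ≤ n → 1 ≤ j → j ≤ n → rankUL w i j = rankUL w' i j) : w = w' := by
  have h0 : ∀ i j, i ≤ n → 1 ≤ j → j ≤ n → rankUL w i j = rankUL w' i j := by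
    intro i j hi hj hj'
    rcases Nat.eq_zero_or_pos i with rfl | h1
    · simp [rankUL]
    · exact h i j h1 hi hj hj'
  ext i
  by_cases hi : i ∈ Finset.Icc 1 n
  · have a := perm_mem hw hi
    have b := perm_mem hw' hi
    obtain ⟨k, rfl⟩ : ∃ k, i = k + 1 := ⟨i - 1, by simp at hi; omega⟩
    have key : ∀ j, 1 ≤ j → j ≤ n → (w (k+1) ∈ Finset.Icc 1 j ↔ w' (k+1) ∈ Finset.Icc 1 j) := by
      intro j hj hj'
      have h1 := h0 (k+1) j (by simp at hi; omega) hj hj'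
      have h2 := h0 k j (by simp at hi; omega) hj hj'
      rw [rankUL_succ, rankUL_succ, h2] at h1
      split_ifs at h1 with p q q
      · exact ⟨fun _ => q, fun _ => p⟩
      · omega
      · omega
      · exact ⟨fun x => absurd x p, fun x => absurd x q⟩
    simp only [Finset.mem_Icc] at a b key
    have k1 := key _ a.1 a.2
    have k2 := key _ b.1 b.2
    omega
  · rw [hw i hi, hw' i hi]

/-- The index equivalence. -/
def finIcc (n : ℕ) : Fin n ≃ {k : ℕ // k ∈ Finset.Icc 1 n} where
  toFun i := ⟨i + 1, by simp⟩
  invFun k := ⟨k.1 - 1, by have := Finset.mem_Icc.1 k.2; omega⟩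
  left_inv i := by simp
  right_inv k := by have := Finset.mem_Icc.1 k.2; exact Subtype.ext (Nat.sub_add_cancel this.1)

/-- Extension of a permutation of `Fin n`. -/
def extP {n : ℕ} (σ : Equiv.Perm (Fin n)) : Equiv.Perm ℕ := σ.extendDomain (finIcc n)

theorem extP_apply {n : ℕ} (σ : Equiv.Perm (Fin n)) (i : Fin n) : extP σ (i+1) = σ i + 1 :=
  Equiv.Perm.extendDomain_apply_image σ (finIcc n) i

theorem extP_isPermOn {n : ℕ} (σ : Equiv.Perm (Fin n)) : IsPermOn n (extP σ) := fun _ hi =>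
  Equiv.Perm.extendDomain_apply_not_subtype σ (finIcc n) hi

theorem extP_inj {n : ℕ} {σ τ : Equiv.Perm (Fin n)} (h : extP σ = extP τ) : σ = τ := by
  ext i
  have := extP_apply σ i
  rw [h, extP_apply] at this
  omega

theorem rankUL_extP {n : ℕ} (σ : Equiv.Perm (Fin n)) (i j : ℕ) (hi : i ≤ n) :
    rankUL (extP σ) i j = Fintype.card {a : Fin n // a.1 < i ∧ (σ a).1 < j} := by
  rw [Fintype.card_subtype]
  unfold rankUL
  symm
  apply Finset.card_bij (fun a _ => a.1 + 1)
  · intro a ha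
    simp [extP_apply] at ha ⊢
    omega
  · intro a _ b _ h
    ext; omega
  · intro b hb
    simp only [Finset.mem_filter, Finset.mem_Icc] at hb
    refine ⟨⟨b - 1, by omega⟩, ?_, by simp; omega⟩
    have := extP_apply σ ⟨b - 1, by omega⟩
    have hb1 : b - 1 + 1 = b := by omega
    simp only [hb1] at this
    simp
    omega

variable {n : ℕ}

theorem flag_zero {E : ℕ → Submodule ℂ (Fin n → ℂ)} (hE : IsCompleteFlag n E) : E 0 = ⊥ :=
  Submodule.finrank_eq_zero.1 (hE.2.1 0 (Nat.zero_le _))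

theorem flag_span {E : ℕ → Submodule ℂ (Fin n → ℂ)} (hE : IsCompleteFlag n E)
    (e : Module.Basis (Fin n) ℂ (Fin n → ℂ)) (he : ∀ i : Fin n, e i ∈ E (i+1)) (i : ℕ)
    (hi : i ≤ n) : E i = Submodule.span ℂ (Set.range fun a : {a : Fin n // a.1 < i} => e a) := by
  symm
  apply Submodule.eq_of_le_of_finrank_eq
  · rw [Submodule.span_le]
    rintro _ ⟨a, rfl⟩
    exact hE.1 _ _ a.2 (he a)
  · have hli : LinearIndependent ℂ (fun a : {a : Fin n // a.1 < i} => e a) :=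
      e.linearIndependent.comp _ Subtype.val_injective
    rw [finrank_span_eq_card hli, hE.2.1 i hi,
      Fintype.card_subtype]
    rw [Finset.card_bij (t := Finset.range i) (fun a _ => a.1)]
    · simp
    · simp
    · intro a _ b _ h; exact Fin.ext h
    · intro b hb
      simp at hb
      exact ⟨⟨b, by omega⟩, by simpa using hb, rfl⟩

/-- Normal form data. -/
def NF (f : (Fin n → ℂ) →ₗ[ℂ] Module.Dual ℂ (Fin n → ℂ)) (E F : ℕ → Submodule ℂ (Fin n → ℂ))
    (σ : Equiv.Perm (Fin n)) (e v : Module.Basis (Fin n) ℂ (Fin n → ℂ)) : Prop :=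
  (∀ i : Fin n, e i ∈ E (i+1)) ∧ (∀ i : Fin n, v i ∈ F (i+1)) ∧
    ∀ i j, f (v j) (e i) = if σ i = j then 1 else 0

theorem rk_NF {f : (Fin n → ℂ) →ₗ[ℂ] Module.Dual ℂ (Fin n → ℂ)}
    {E F : ℕ → Submodule ℂ (Fin n → ℂ)} (hE : IsCompleteFlag n E) (hF : IsCompleteFlag n F)
    {σ : Equiv.Perm (Fin n)} {e v : Module.Basis (Fin n) ℂ (Fin n → ℂ)} (h : NF f E F σ e v)
    (i j : ℕ) (hi : i ≤ n) (hj : j ≤ n) : rkFE f (F j) (E i) = rankUL (extP σ) i j := by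
  obtain ⟨he, hv, hp⟩ := h
  rw [rankUL_extP σ i j hi]
  unfold rkFE
  have hli : LinearIndependent ℂ (fun a : {a : Fin n // a.1 < i ∧ (σ a).1 < j} =>
      (E i).subtype.dualMap (f (v (σ a)))) := by
    rw [Fintype.linearIndependent_iff]
    intro g hg a
    have := congrArg (fun φ => φ ⟨e a, hE.1 _ _ a.2.1 (he a)⟩) hg
    simpa [hp, Subtype.val_inj] using this
  rw [← finrank_span_eq_card hli]
  have : LinearMap.range ((E i).subtype.dualMap ∘ₗ (f ∘ₗ (F j).subtype)) =
      (F j).map ((E i).subtype.dualMap ∘ₗ f) := by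
    rw [← LinearMap.comp_assoc, LinearMap.range_comp, Submodule.range_subtype]
  rw [this]
  suffices hs : (F j).map ((E i).subtype.dualMap ∘ₗ f) = Submodule.span ℂ (Set.range
      (fun a : {a : Fin n // a.1 < i ∧ (σ a).1 < j} => (E i).subtype.dualMap (f (v (σ a))))) by
    rw [hs]
  apply le_antisymm
  · rw [flag_span hF v hv j hj, Submodule.map_span, Submodule.span_le]
    rintro _ ⟨_, ⟨b, rfl⟩, rfl⟩
    by_cases hb : (σ.symm b).1 < i
    · apply Submodule.subset_span
      exact ⟨⟨σ.symm b, hb, by simpa using b.2⟩, by simp⟩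
    · have : ((E i).subtype.dualMap ∘ₗ f) (v b) = 0 := by
        have hle : E i ≤ LinearMap.ker (f (v b)) := by
          rw [flag_span hE e he i hi, Submodule.span_le]
          rintro _ ⟨a, rfl⟩
          simp only [SetLike.mem_coe, LinearMap.mem_ker, hp]
          rw [if_neg]
          intro hab
          apply hb
          rw [← hab]
          simpa using a.2
        ext x
        exact hle x.2
      simp only [this]
      exact Submodule.zero_mem _
  · rw [Submodule.span_le]
    rintro _ ⟨a, rfl⟩
    exact ⟨v (σ a), hF.1 _ _ a.2.2 (hv _), rfl⟩

theorem exists_NF {f : (Fin n → ℂ) →ₗ[ℂ] Module.Dual ℂ (Fin n → ℂ)}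
    (hf : Function.Bijective f)
    {E F : ℕ → Submodule ℂ (Fin n → ℂ)} (hE : IsCompleteFlag n E) (hF : IsCompleteFlag n F) :
    ∃ σ e v, NF f E F σ e v := by
  set G : ℕ → Submodule ℂ (Fin n → ℂ) := fun j => ((F j).map f).dualCoannihilator with hG
  have memG : ∀ j x, x ∈ G j ↔ ∀ v ∈ F j, f v x = 0 := by
    intro j x
    simp [hG, Submodule.mem_dualCoannihilator]
  have hGF : ∀ j v, (∀ x ∈ G j, f v x = 0) → v ∈ F j := by
    intro j v h
    have : f v ∈ (G j).dualAnnihilator := (Submodule.mem_dualAnnihilator _).2 h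
    rw [hG, Subspace.dualCoannihilator_dualAnnihilator_eq] at this
    obtain ⟨u, hu, huv⟩ := this
    rwa [← hf.1 huv]
  have G0 : G 0 = ⊤ := by
    rw [eq_top_iff]; intro x _
    rw [memG, flag_zero hF]
    intro v hv
    simp [(Submodule.mem_bot ℂ).1 hv]
  have Gn : G n = ⊥ := by
    rw [eq_bot_iff]; intro x hx
    rw [memG, hF.2.2] at hx
    rw [Submodule.mem_bot, ← Module.forall_dual_apply_eq_zero_iff ℂ]
    intro φ
    obtain ⟨v, rfl⟩ := hf.2 φ
    exact hx v trivial
  have Gmono : ∀ i j, i ≤ j → G j ≤ G i := by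
    intro i j hij x hx
    rw [memG] at hx ⊢
    exact fun v hv => hx v (hF.1 _ _ hij hv)
  -- vectors spanning each step of F
  have hFstep : ∀ j, j < n → ∃ u ∈ F (j+1), F (j+1) ≤ F j ⊔ Submodule.span ℂ {u} := by
    intro j hj
    have hlt : F j < F (j+1) := by
      refine lt_of_le_of_ne (hF.1 _ _ (by omega)) fun h => ?_
      have a := hF.2.1 j (by omega)
      have b := hF.2.1 (j+1) (by omega)
      rw [← h] at b
      omega
    obtain ⟨u, hu, hu'⟩ := SetLike.exists_of_lt hlt
    refine ⟨u, hu, ?_⟩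
    have hle : F j ⊔ Submodule.span ℂ {u} ≤ F (j+1) :=
      sup_le hlt.le (by simpa [Submodule.span_le] using hu)
    refine (Submodule.eq_of_le_of_finrank_le hle ?_).ge
    rw [hF.2.1 (j+1) (by omega)]
    have : F j < F j ⊔ Submodule.span ℂ {u} := by
      refine lt_of_le_of_ne le_sup_left fun h => hu' ?_
      rw [h]
      exact Submodule.mem_sup_right (Submodule.mem_span_singleton_self u)
    have := Submodule.finrank_lt_finrank_of_lt this
    rw [hF.2.1 j (by omega)] at this
    omega
  have hGstep : ∀ j, j < n → ∀ x ∈ G j, ∀ y ∈ G j, y ∉ G (j+1) → ∃ c : ℂ, x - c • y ∈ G (j+1) := by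
    intro j hj x hx y hy hy'
    obtain ⟨u, hu, hle⟩ := hFstep j hj
    have crit : ∀ z ∈ G j, f u z = 0 → z ∈ G (j+1) := by
      intro z hz hz'
      rw [memG] at hz ⊢
      intro v hv
      obtain ⟨a, ha, b, hb, rfl⟩ := Submodule.mem_sup.1 (hle hv)
      obtain ⟨c, rfl⟩ := Submodule.mem_span_singleton.1 hb
      simp [hz a ha, hz']
    have hne : f u y ≠ 0 := fun h => hy' (crit y hy h)
    refine ⟨f u x / f u y, crit _ (Submodule.sub_mem _ hx (Submodule.smul_mem _ _ hy)) ?_⟩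
    simp [hne]
  -- choice
  have hEne : ∀ i, i < n → ¬ E (i+1) ≤ E i := by
    intro i hi h
    have := Submodule.finrank_mono h
    rw [hE.2.1 _ (by omega), hE.2.1 _ (by omega)] at this
    omega
  have hch : ∀ i : Fin n, ∃ (k : Fin n) (x : Fin n → ℂ), x ∈ E (i+1) ∧ x ∉ E i ∧ x ∈ G k ∧
      E (i+1) ⊓ G (k+1) ≤ E i := by
    intro i
    have hex : ∃ j, E (i+1) ⊓ G j ≤ E i := ⟨n, by simp [Gn]⟩
    have hs := Nat.find_spec hex
    have hm := fun m => Nat.find_min hex (m := m)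
    have hn : Nat.find hex ≤ n := Nat.find_min' hex (by simp [Gn])
    generalize Nat.find hex = j at *
    rcases j with _ | k
    · rw [G0, inf_top_eq] at hs
      exact absurd hs (hEne i i.2)
    · obtain ⟨x, hx, hx'⟩ := SetLike.not_le_iff_exists.1 (hm k (by omega))
      exact ⟨⟨k, by omega⟩, x, hx.1, hx', hx.2, hs⟩
  choose s e0 h1 h2 h3 h4 using hch
  have h5 : ∀ i, e0 i ∉ G (s i + 1) := fun i h => h2 i (h4 i ⟨h1 i, h⟩)
  have sinj : ∀ i i' : Fin n, i < i' → s i ≠ s i' := by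
    intro i i' hlt heq
    have a := h3 i
    have b := h5 i
    rw [heq] at a b
    obtain ⟨c, hc⟩ := hGstep _ (s i').2 _ (h3 i') _ a b
    have hi : c • e0 i ∈ E i' := Submodule.smul_mem _ _ (hE.1 _ _ (by simpa using hlt) (h1 i))
    have := h4 i' ⟨Submodule.sub_mem _ (h1 i') (hE.1 _ _ (Nat.le_succ _) hi), hc⟩
    exact h2 i' (by simpa using Submodule.add_mem _ this hi)
  have sinj' : Function.Injective s := by
    intro i i' h
    rcases lt_trichotomy i i' with hl | hl | hl
    · exact absurd h (sinj _ _ hl)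
    · exact hl
    · exact absurd h.symm (sinj _ _ hl)
  let σ : Equiv.Perm (Fin n) := Equiv.ofBijective s (Finite.injective_iff_bijective.1 sinj')
  have hli : LinearIndependent ℂ e0 := by
    rw [Fintype.linearIndependent_iff]
    intro g hg
    -- downward
    have key : ∀ m : ℕ, ∀ i : Fin n, n - i.1 ≤ m → g i = 0 := by
      intro m
      induction m with
      | zero => intro i hi; omega
      | succ m ih =>
        intro i hi
        by_contra hgi
        rw [← Finset.add_sum_erase _ _ (Finset.mem_univ i)] at hg
        have hmem : ∑ x ∈ Finset.univ.erase i, g x • e0 x ∈ E i := by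
          refine Submodule.sum_mem _ fun b hb => ?_
          rcases lt_or_gt_of_ne (Finset.ne_of_mem_erase hb) with hl | hl
          · exact Submodule.smul_mem _ _ (hE.1 _ _ (by simpa using hl) (h1 b))
          · rw [ih b (by have : i.1 < b.1 := hl
                         omega), zero_smul]
            exact Submodule.zero_mem _
        rw [eq_neg_of_add_eq_zero_right hg, Submodule.neg_mem_iff,
          Submodule.smul_mem_iff _ hgi] at hmem
        exact h2 i hmem
    exact fun i => key n i (by omega)
  let e : Module.Basis (Fin n) ℂ (Fin n → ℂ) := basisOfLinearIndependentOfCardEqFinrank' e0 hli (by simp)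
  have hee : ∀ i, e i = e0 i := fun i => by simp [e]
  let fe : (Fin n → ℂ) ≃ₗ[ℂ] Module.Dual ℂ (Fin n → ℂ) := LinearEquiv.ofBijective f hf
  let v : Module.Basis (Fin n) ℂ (Fin n → ℂ) := (e.dualBasis.map fe.symm).reindex σ
  have hfv : ∀ j, f (v j) = e.coord (σ.symm j) := by
    intro j
    have : fe (v j) = e.coord (σ.symm j) := by simp [v]
    exact this
  refine ⟨σ, e, v, fun i => by rw [hee]; exact h1 i, fun j => hGF _ _ ?_, ?_⟩
  · intro x hx
    rw [hfv]
    have key : ∀ m : ℕ, ∀ b : Fin n, (s b).1 = m → m ≤ j.1 → e.repr x b = 0 := by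
      intro m
      induction m using Nat.strong_induction_on with
      | _ m ih =>
        intro b hb hm
        by_contra hgb
        have hs := e.sum_repr x
        rw [← Finset.add_sum_erase _ _ (Finset.mem_univ b)] at hs
        have hmem : ∑ a ∈ Finset.univ.erase b, e.repr x a • e a ∈ G (s b + 1) := by
          refine Submodule.sum_mem _ fun a ha => ?_
          have hne : (s a).1 ≠ (s b).1 :=
            fun h => Finset.ne_of_mem_erase ha (sinj' (Fin.ext h))
          rcases lt_or_gt_of_ne hne with hl | hl
          · rw [ih _ (by omega) a rfl (by omega), zero_smul]
            exact Submodule.zero_mem _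
          · rw [hee]
            exact Submodule.smul_mem _ _ (Gmono _ _ hl (h3 a))
        have hx' : x ∈ G (s b + 1) := Gmono _ _ (by omega) hx
        have := Submodule.sub_mem _ hx' hmem
        rw [← eq_sub_of_add_eq hs, Submodule.smul_mem_iff _ hgb, hee] at this
        exact h5 b this
    refine key _ (σ.symm j) rfl ?_
    have : s (σ.symm j) = j := σ.apply_symm_apply j
    rw [this]
  · intro i j
    rw [hfv]
    simp only [Module.Basis.coord_apply, Module.Basis.repr_self, Finsupp.single_apply,
      Equiv.eq_symm_apply]

theorem orbit_description_Gr (n : ℕ)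
    (f f' : (Fin n → ℂ) →ₗ[ℂ] Module.Dual ℂ (Fin n → ℂ))
    (hf : Function.Bijective f) (hf' : Function.Bijective f')
    (E F E' F' : ℕ → Submodule ℂ (Fin n → ℂ))
    (hE : IsCompleteFlag n E) (hF : IsCompleteFlag n F)
    (hE' : IsCompleteFlag n E') (hF' : IsCompleteFlag n F') :
    (∃! w : Equiv.Perm ℕ, IsPermOn n w ∧
      ∀ i j, 1 ≤ i → i ≤ n → 1 ≤ j → j ≤ n →
        rkFE f (F j) (E i) = rankUL w i j) ∧
    ((∀ i j, 1 ≤ i → i ≤ n → 1 ≤ j → j ≤ n →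
        rkFE f (F j) (E i) = rkFE f' (F' j) (E' i)) ↔
      ∃ g₁ g₂ : (Fin n → ℂ) ≃ₗ[ℂ] (Fin n → ℂ),
        (∀ v, f' v = g₁.dualMap.symm (f (g₂.symm v))) ∧
        (∀ i, 1 ≤ i → i ≤ n →
          E' i = (E i).map (g₁ : (Fin n → ℂ) →ₗ[ℂ] (Fin n → ℂ)) ∧
          F' i = (F i).map (g₂ : (Fin n → ℂ) →ₗ[ℂ] (Fin n → ℂ)))) := by
  obtain ⟨σ, e, v, h⟩ := exists_NF hf hE hF
  refine ⟨⟨extP σ, ⟨extP_isPermOn σ, fun i j _ hi _ hj => rk_NF hE hF h i j hi hj⟩, ?_⟩, ?_, ?_⟩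
  · rintro w ⟨hw, hw'⟩
    refine perm_unique hw (extP_isPermOn σ) fun i j hi hi' hj hj' => ?_
    rw [← hw' i j hi hi' hj hj', rk_NF hE hF h i j hi' hj']
  · intro hr
    obtain ⟨σ', e', v', h'⟩ := exists_NF hf' hE' hF'
    have : σ = σ' := by
      refine extP_inj (perm_unique (extP_isPermOn σ) (extP_isPermOn σ') ?_)
      intro i j hi hi' hj hj'
      rw [← rk_NF hE hF h i j hi' hj', ← rk_NF hE' hF' h' i j hi' hj', hr i j hi hi' hj hj']
    subst this
    let g₁ := e.equiv e' (Equiv.refl _)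
    let g₂ := v.equiv v' (Equiv.refl _)
    have hg₁ : ∀ i, g₁ (e i) = e' i := fun i => by simp [g₁]
    have hg₂ : ∀ i, g₂ (v i) = v' i := fun i => by simp [g₂]
    refine ⟨g₁, g₂, ?_, fun i _ hi => ⟨?_, ?_⟩⟩
    · intro x
      obtain ⟨y, rfl⟩ := g₂.surjective x
      rw [LinearEquiv.symm_apply_apply, LinearEquiv.eq_symm_apply]
      have : (g₁.dualMap : _ →ₗ[ℂ] _) ∘ₗ f' ∘ₗ (g₂ : (Fin n → ℂ) →ₗ[ℂ] (Fin n → ℂ)) = f := by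
        refine v.ext fun j => e.ext fun i => ?_
        simp [LinearEquiv.dualMap_apply, hg₁, hg₂, h.2.2, h'.2.2]
      exact LinearMap.congr_fun this y
    · rw [flag_span hE e h.1 i hi, flag_span hE' e' h'.1 i hi, Submodule.map_span, ← Set.range_comp]
      congr 2
      ext1 a
      exact (hg₁ a).symm
    · rw [flag_span hF v h.2.1 i hi, flag_span hF' v' h'.2.1 i hi, Submodule.map_span,
        ← Set.range_comp]
      congr 2
      ext1 a
      exact (hg₂ a).symm
  · rintro ⟨g₁, g₂, hg, hm⟩ i j hi hi' hj hj'
    have h' : NF f' E' F' σ (e.map g₁) (v.map g₂) := by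
      refine ⟨fun i => ?_, fun i => ?_, fun i j => ?_⟩
      · rw [(hm (i+1) (by omega) (by omega)).1]
        exact ⟨e i, h.1 i, by simp⟩
      · rw [(hm (i+1) (by omega) (by omega)).2]
        exact ⟨v i, h.2.1 i, by simp⟩
      · rw [hg, ← h.2.2]
        simp [LinearEquiv.dualMap_symm, LinearEquiv.dualMap_apply]
    rw [rk_NF hE hF h i j hi' hj', rk_NF hE' hF' h' i j hi' hj']
end UGS
end
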